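/- arXiv:1709.09285 — 4 statements merged into one kernel-verified Lean document; each statement's English description precedes it below -/
import Mathlib

section
/- Let G be a non-cyclic finite abelian group, written G = H ⊕ ⟨g⟩ with ⟨g⟩ ≅ C_{exp(G)} and H a nontrivial subgroup. Let S be the sequence consisting of g repeated exp(G) − 1 times together with each element h of H repeated exp(G) times. Then |S| = |G| + exp(G) − 1 and Σ_{|G|}(S) ≠ G. -/
/-- The set of `n`-term subsequence sums of the finite sequence (multiset) `S`. -/
def subseqSums {G : Type*} [AddCommGroup G] (S : Multiset G) (n : ℕ) : Set G :=
  {x | ∃ T ≤ S, Multiset.card T = n ∧ T.sum = x}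

/-- Complementary subgroups of an abelian group have orders whose product is the order of the
group. -/
theorem AddSubgroup.card_mul_card_of_isCompl {G : Type*} [AddCommGroup G] {H K : AddSubgroup G}
    (h : IsCompl H K) : Nat.card H * Nat.card K = Nat.card G := by
  rw [← Nat.card_prod]
  refine Nat.card_congr (.ofBijective _ ⟨add_injective_of_disjoint h.disjoint, fun x => ?_⟩)
  obtain ⟨y, hy, z, hz, rfl⟩ := AddSubgroup.mem_sup.1 (h.sup_eq_top ▸ AddSubgroup.mem_top x)
  exact ⟨(⟨y, hy⟩, ⟨z, hz⟩), rfl⟩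

/-- If `⟨g⟩` meets `H` trivially, and the terms of a sequence of length `addOrderOf g - 1` are
equal to `g` or lie in `H`, then its sum lies in the coset `H - g` only if it equals `-g`. -/
theorem Multiset.sum_add_eq_zero_of_mem {G : Type*} [AddCommGroup G] {H : AddSubgroup G} {g : G}
    (hdisj : Disjoint H (AddSubgroup.zmultiples g)) {U : Multiset G}
    (hU : ∀ x ∈ U, x = g ∨ x ∈ H) (hcard : card U + 1 = addOrderOf g)
    (hmem : U.sum + g ∈ H) : U.sum + g = 0 := by
  classical
  have hsplit := filter_add_not (· ∈ H) U
  have hrep := eq_replicate_card.2 fun x (hx : x ∈ U.filter (· ∉ H)) =>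
    (hU x (mem_filter.1 hx).1).resolve_right (mem_filter.1 hx).2
  set A := U.filter (· ∈ H)
  set c := card (U.filter (· ∉ H))
  rw [hrep] at hsplit
  have hAmem : A.sum ∈ H := H.multiset_sum_mem A fun x hx => of_mem_filter hx
  have hsum : U.sum + g = A.sum + (c + 1) • g := by
    rw [← hsplit, sum_add, sum_replicate, succ_nsmul, add_assoc]
  have hcardU : card U = card A + c := by
    rw [← hsplit, card_add, card_replicate]
  have hzero : (c + 1) • g = 0 := by
    refine AddSubgroup.disjoint_def.1 hdisj ?_ (AddSubgroup.nsmul_mem_zmultiples g _)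
    rwa [hsum, H.add_mem_cancel_left hAmem] at hmem
  have hle := Nat.le_of_dvd c.succ_pos (addOrderOf_dvd_of_nsmul_eq_zero hzero)
  have hAzero : A = 0 := card_eq_zero.1 (by omega)
  rw [hsum, hzero, hAzero, sum_zero, add_zero]

open scoped Classical in
theorem stmt_7 {G : Type*} [AddCommGroup G] [Fintype G]
    (hnoncyc : ¬ IsAddCyclic G)
    (H : AddSubgroup G) (hHnontriv : H ≠ ⊥) (g : G)
    (hord : addOrderOf g = AddMonoid.exponent G)
    (hcompl : IsCompl H (AddSubgroup.zmultiples g))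
    (S : Multiset G)
    (hS : S = Multiset.replicate (AddMonoid.exponent G - 1) g +
        ((H : Set G).toFinset.val.bind fun h =>
          Multiset.replicate (AddMonoid.exponent G) h)) :
    Multiset.card S = Nat.card G + AddMonoid.exponent G - 1 ∧
      subseqSums S (Nat.card G) ≠ Set.univ := by
  have hpos : 0 < AddMonoid.exponent G := hord ▸ addOrderOf_pos g
  have hcardG : Nat.card H * AddMonoid.exponent G = Nat.card G := by
    rw [← hord, ← Nat.card_zmultiples, AddSubgroup.card_mul_card_of_isCompl hcompl]
  have hcardS : Multiset.card S = Nat.card G + AddMonoid.exponent G - 1 := by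
    have hH : (H : Set G).toFinset.card = Nat.card H := by
      rw [Set.toFinset_card, ← Nat.card_eq_fintype_card]; rfl
    simp only [hS, Multiset.card_add, Multiset.card_replicate, Multiset.card_bind,
      Function.comp_def, Multiset.map_const', Multiset.sum_replicate, Finset.card_val, hH,
      smul_eq_mul, hcardG]
    omega
  refine ⟨hcardS, fun huniv => ?_⟩
  obtain ⟨h, hhH, hh⟩ := H.bot_or_exists_ne_zero.resolve_left hHnontriv
  obtain ⟨T, hTS, hTcard, hTsum⟩ := huniv.symm ▸ Set.mem_univ (S.sum - (h - g))
  have hadd : S - T + T = S := Multiset.sub_add_cancel hTS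
  have hsum : (S - T).sum + g = h := by
    have hsumS := congrArg Multiset.sum hadd
    rw [Multiset.sum_add, hTsum] at hsumS
    rw [eq_sub_of_add_eq hsumS]
    abel
  have hcard : Multiset.card (S - T) + 1 = addOrderOf g := by
    rw [Multiset.card_sub hTS, hcardS, hTcard, hord]
    omega
  refine hh (hsum ▸ Multiset.sum_add_eq_zero_of_mem hcompl.disjoint (fun x hx => ?_) hcard
    (hsum.symm ▸ hhH))
  have hxS := Multiset.mem_of_le (Multiset.sub_le_self S T) hx
  rw [hS, Multiset.mem_add, Multiset.mem_bind] at hxS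
  rcases hxS with hx | ⟨y, hy, hxy⟩
  · exact .inl (Multiset.eq_of_mem_replicate hx)
  · rw [Multiset.eq_of_mem_replicate hxy]
    exact .inr (Set.mem_toFinset.1 hy)
end

section
/- Let G be a finite abelian group, let A ⊆ G be a nonempty subset with ⟨A⟩_* = G, and let n ≥ 1 be an integer with n ≥ exp(G) and n·|A| > |G|. Then nA = G. -/
open Pointwise

open Finset in
/-- Existence of Hamidoune atoms: among the sets `X` with `j ≤ #X` and `#(X + S) + j ≤ #G`, those
minimising `#(X + S) - #X` and then `#X` meet each of their other translates in fewer than `j`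
points. -/
theorem exists_atom {G : Type*} [AddCommGroup G] [Fintype G] [DecidableEq G]
    (S Y : Finset G) (j : ℕ) (hY : j ≤ #Y) (hYS : #(Y + S) + j ≤ Fintype.card G) :
    ∃ X : Finset G, j ≤ #X ∧ #(X + S) + j ≤ Fintype.card G ∧
      #(X + S) + #Y ≤ #(Y + S) + #X ∧ ∀ g : G, g +ᵥ X = X ∨ #(X ∩ (g +ᵥ X)) < j := by
  let f : Finset G → ℤ := fun X => #(X + S) - #X
  let P : Finset G → Prop := fun X => j ≤ #X ∧ #(X + S) + j ≤ Fintype.card G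
  obtain ⟨X₀, hX₀, hmin₀⟩ := exists_min_image (univ.filter P) f ⟨Y, by simp [P, hY, hYS]⟩
  obtain ⟨X, hX, hmin⟩ := exists_min_image ((univ.filter P).filter (f · ≤ f X₀)) card
    ⟨X₀, by simpa using hX₀⟩
  simp only [mem_filter, mem_univ, true_and] at hX₀ hmin₀ hX hmin
  obtain ⟨⟨hXj, hXS⟩, hfX⟩ := hX
  have hf : ∀ Z, P Z → f X ≤ f Z := fun Z hZ => hfX.trans (hmin₀ Z hZ)
  have hc : ∀ Z, P Z → f Z ≤ f X → #X ≤ #Z := fun Z hZ h => hmin Z ⟨hZ, h.trans hfX⟩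
  refine ⟨X, hXj, hXS, ?_, fun g => ?_⟩
  · have := hf Y ⟨hY, hYS⟩
    simp only [f] at this
    omega
  by_contra! hcon
  obtain ⟨hne, hcard⟩ := hcon
  have hdual : 2 * (#X : ℤ) + f X ≤ Fintype.card G := by
    have h1 : #(-(X + S)ᶜ) = Fintype.card G - #(X + S) := by
      rw [card_neg, card_compl]
    have h2 : #(-(X + S)ᶜ + S) ≤ Fintype.card G - #X := by
      rw [← card_compl, ← card_neg (Xᶜ)]
      refine card_le_card fun z hz => ?_
      obtain ⟨y, hy, s, hs, rfl⟩ := mem_add.1 hz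
      rw [mem_neg', mem_compl] at hy ⊢
      intro h
      exact hy (mem_add.2 ⟨_, h, s, hs, by abel⟩)
    have h3 := card_le_univ X
    have := hc (-(X + S)ᶜ) ⟨by omega, by omega⟩ (by simp only [f]; omega)
    simp only [f]
    omega
  have htr : #((g +ᵥ X) + S) = #(X + S) := by
    rw [vadd_add_assoc, card_vadd_finset]
  have hgX : #(g +ᵥ X) = #X := card_vadd_finset g X
  have h1 := card_union_add_card_inter X (g +ᵥ X)
  have h2 := card_union_add_card_inter (X + S) ((g +ᵥ X) + S)
  rw [← union_add] at h2
  have h3 := card_le_card (inter_add_subset (s₁ := X) (s₂ := g +ᵥ X) (t := S))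
  have h4 : #(X ∩ (g +ᵥ X)) < #X := by
    refine card_lt_card ⟨inter_subset_left, fun h => hne ?_⟩
    exact (eq_of_subset_of_card_le (h.trans inter_subset_right) hgX.le).symm
  have h5 : #(X ∩ (g +ᵥ X) + S) ≤ #(X + S) :=
    card_le_card (add_subset_add_right inter_subset_left)
  have hP : P (X ∩ (g +ᵥ X)) := ⟨hcard, by omega⟩
  have h6 := hf _ hP
  have h7 : ¬ f (X ∩ (g +ᵥ X)) ≤ f X := fun h => by
    have := hc _ hP h
    omega
  by_cases hU : P (X ∪ (g +ᵥ X))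
  · have := hf _ hU
    simp only [f] at *
    omega
  · have : ¬ #(X ∪ (g +ᵥ X) + S) + j ≤ Fintype.card G := fun h => hU ⟨by omega, h⟩
    simp only [f] at *
    omega

open Finset in
theorem exists_addSubgroup_of_stabilizer {G : Type*} [AddCommGroup G] [DecidableEq G]
    {X : Finset G} (hX : X.Nonempty) (h : ∀ x ∈ X, ∀ y ∈ X, (x - y) +ᵥ X = X) :
    ∃ (K : AddSubgroup G) (g : G), ∀ z, z ∈ g +ᵥ X ↔ z ∈ K := by
  obtain ⟨x, hx⟩ := hX
  refine ⟨AddAction.stabilizer G X, -x, fun z => ?_⟩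
  rw [AddAction.mem_stabilizer_iff, mem_vadd_finset]
  constructor
  · rintro ⟨y, hy, rfl⟩
    have := h y hy x hx
    rwa [vadd_eq_add, neg_add_eq_sub]
  · intro hz
    refine ⟨z + x, ?_, by rw [vadd_eq_add]; abel⟩
    rw [← hz]
    exact mem_vadd_finset.2 ⟨x, hx, rfl⟩

open Finset in
theorem exists_addSubgroup_card_add_le {G : Type*} [AddCommGroup G] [Fintype G] [DecidableEq G]
    (S Y : Finset G) (hY : Y.Nonempty) (hYS : Y + S ≠ univ) :
    ∃ (K : AddSubgroup G) (X : Finset G), (∀ z, z ∈ X ↔ z ∈ K) ∧ X + S ≠ univ ∧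
      #(X + S) + #Y ≤ #(Y + S) + #X := by
  obtain ⟨X, h1, h2, h3, h4⟩ := exists_atom S Y 1 hY.card_pos
    (by have := card_lt_univ_of_notMem (s := Y + S) (x := _)
          (by simpa [eq_univ_iff_forall] using hYS : ∃ x, x ∉ Y + S).choose_spec
        omega)
  obtain ⟨K, g, hK⟩ := exists_addSubgroup_of_stabilizer (card_pos.1 h1) fun x hx y hy => by
    refine (h4 (x - y)).resolve_right fun h => ?_
    rw [Nat.lt_one_iff, card_eq_zero, ← not_nonempty_iff_eq_empty] at h
    exact h ⟨x, mem_inter.2 ⟨hx, mem_vadd_finset.2 ⟨y, hy, by simp⟩⟩⟩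
  have h5 : #((g +ᵥ X) + S) = #(X + S) := by rw [vadd_add_assoc, card_vadd_finset]
  refine ⟨K, g +ᵥ X, hK, fun h => ?_, by rwa [h5, card_vadd_finset]⟩
  rw [h, card_univ] at h5
  omega

open Finset in
theorem exists_addSubgroup_or_sidon {G : Type*} [AddCommGroup G] [Fintype G] [DecidableEq G]
    (S Y : Finset G) (hY : 2 ≤ #Y) (hYS : #(Y + S) + 2 ≤ Fintype.card G) :
    ∃ X : Finset G, 2 ≤ #X ∧ 0 ∈ X ∧ #(X + S) + 2 ≤ Fintype.card G ∧
      #(X + S) + #Y ≤ #(Y + S) + #X ∧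
      ((∃ K : AddSubgroup G, ∀ z, z ∈ X ↔ z ∈ K) ∨ ∀ g : G, g ≠ 0 → #(X ∩ (g +ᵥ X)) ≤ 1) := by
  obtain ⟨X, h1, h2, h3, h4⟩ := exists_atom S Y 2 hY hYS
  have hXne : X.Nonempty := card_pos.1 (by omega)
  have tr : ∀ g : G, #((g +ᵥ X) + S) = #(X + S) := fun g => by
    rw [vadd_add_assoc, card_vadd_finset]
  by_cases hs : ∃ g : G, g ≠ 0 ∧ g +ᵥ X = X
  · obtain ⟨g, hg0, hg⟩ := hs
    obtain ⟨K, a, hK⟩ := exists_addSubgroup_of_stabilizer hXne fun x hx y hy => by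
      refine (h4 (x - y)).resolve_right fun h => ?_
      have hx' : x ∈ X ∩ ((x - y) +ᵥ X) :=
        mem_inter.2 ⟨hx, mem_vadd_finset.2 ⟨y, hy, by simp⟩⟩
      have hmem : ∀ z ∈ X, g + z ∈ X := fun z hz => by
        rw [← hg]; exact mem_vadd_finset.2 ⟨z, hz, rfl⟩
      have hx'' : g + x ∈ X ∩ ((x - y) +ᵥ X) :=
        mem_inter.2 ⟨hmem x hx, mem_vadd_finset.2 ⟨g + y, hmem y hy, by simp; abel⟩⟩
      have := card_le_one.1 (Nat.le_of_lt_succ h) _ hx' _ hx''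
      exact hg0 (by simpa using this)
    exact ⟨a +ᵥ X, by rwa [card_vadd_finset], (hK 0).2 K.zero_mem, by rwa [tr],
      by rwa [tr, card_vadd_finset], .inl ⟨K, hK⟩⟩
  · push Not at hs
    obtain ⟨x, hx⟩ := hXne
    refine ⟨-x +ᵥ X, by rwa [card_vadd_finset], mem_vadd_finset.2 ⟨x, hx, by simp⟩, by rwa [tr],
      by rwa [tr, card_vadd_finset], .inr fun g hg => ?_⟩
    rw [vadd_comm, ← vadd_finset_inter, card_vadd_finset]
    exact Nat.le_of_lt_succ ((h4 g).resolve_left (hs g hg))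

open Finset in
theorem two_mul_card_mul_card_le_of_sidon {G : Type*} [AddCommGroup G] [DecidableEq G]
    {M : Finset G} (hM : ∀ g : G, g ≠ 0 → #(M ∩ (g +ᵥ M)) ≤ 1) (N : Finset G) :
    2 * #N * #M + #N ≤ 2 * #(N + M) + #N * #N := by
  induction N using Finset.induction_on with
  | empty => simp
  | insert b N hb ih =>
    have h1 : #((b +ᵥ M) ∩ (N + M)) ≤ #N := by
      have : (b +ᵥ M) ∩ (N + M) ⊆ N.biUnion fun c => (b +ᵥ M) ∩ (c +ᵥ M) := by
        intro z hz
        obtain ⟨hz1, hz2⟩ := mem_inter.1 hz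
        obtain ⟨c, hc, m, hm, rfl⟩ := mem_add.1 hz2
        exact mem_biUnion.2 ⟨c, hc, mem_inter.2 ⟨hz1, mem_vadd_finset.2 ⟨m, hm, rfl⟩⟩⟩
      refine (card_le_card this).trans (card_biUnion_le.trans ?_)
      refine (sum_le_card_nsmul N _ 1 fun c hc => ?_).trans (by simp)
      have hbc : c - b ≠ 0 := fun h => hb (by rwa [← sub_eq_zero.1 h])
      have := hM _ hbc
      rwa [← card_vadd_finset b, vadd_finset_inter, vadd_vadd, add_sub_cancel] at this
    have h2 := card_union_add_card_inter (b +ᵥ M) (N + M)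
    have h3 : insert b N + M = (b +ᵥ M) ∪ (N + M) := by
      rw [insert_eq, union_add, singleton_add]
    rw [h3, card_insert_of_notMem hb]
    rw [card_vadd_finset] at h2
    nlinarith

open Finset in
theorem card_add_card_le_of_sidon_of_addSubgroup {G : Type*} [AddCommGroup G] [DecidableEq G]
    {M : Finset G} (hM : ∀ g : G, g ≠ 0 → #(M ∩ (g +ᵥ M)) ≤ 1) (h0 : 0 ∈ M)
    (K : AddSubgroup G) (X : Finset G) (hX : ∀ z, z ∈ X ↔ z ∈ K) (hX2 : 2 ≤ #X)
    (hMK : ∃ m ∈ M, m ∉ K) : #X + #M ≤ #(X + M) := by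
  obtain ⟨m, hm, hmK⟩ := hMK
  have h1 : 2 * #X ≤ #(X + M) := by
    have hd : Disjoint X (m +ᵥ X) := by
      rw [disjoint_left]
      intro z hz hz'
      obtain ⟨y, hy, rfl⟩ := mem_vadd_finset.1 hz'
      rw [hX] at hy hz
      exact hmK ((K.add_mem_cancel_right hy).1 hz)
    have : X ∪ (m +ᵥ X) ⊆ X + M := by
      refine union_subset (fun z hz => mem_add.2 ⟨z, hz, 0, h0, add_zero z⟩) fun z hz => ?_
      obtain ⟨y, hy, rfl⟩ := mem_vadd_finset.1 hz
      exact mem_add.2 ⟨y, hy, m, hm, add_comm y m⟩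
    have := card_le_card this
    rw [card_union_of_disjoint hd, card_vadd_finset] at this
    omega
  rcases le_or_gt #M #X with h | h
  · omega
  · have := two_mul_card_mul_card_le_of_sidon hM X
    nlinarith [Nat.mul_le_mul_left (#X - 1) h, Nat.sub_add_cancel (by omega : 1 ≤ #X)]

open Finset in
theorem sidon_card_add {G : Type*} [AddCommGroup G] [Fintype G] [DecidableEq G]
    {M : Finset G} (hM : ∀ g : G, g ≠ 0 → #(M ∩ (g +ᵥ M)) ≤ 1) (h0 : 0 ∈ M)
    (hgen : AddSubgroup.closure (M : Set G) = ⊤) {Y : Finset G} (hY : Y.Nonempty)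
    (hYM : Y + M ≠ univ) : #Y + #M ≤ #(Y + M) + 1 := by
  obtain ⟨K, X, hX, hXM, hle⟩ := exists_addSubgroup_card_add_le M Y hY hYM
  have hX1 : 1 ≤ #X := card_pos.2 ⟨0, (hX 0).2 K.zero_mem⟩
  rcases hX1.lt_or_eq with h | h
  · have := card_add_card_le_of_sidon_of_addSubgroup hM h0 K X hX h (by
      by_contra! hc
      have hK : K = ⊤ := top_le_iff.1 (hgen ▸ (AddSubgroup.closure_le K).2 hc)
      refine hXM (eq_univ_iff_forall.2 fun z => mem_add.2 ⟨z, ?_, 0, h0, add_zero z⟩)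
      rw [hX, hK]; trivial)
    omega
  · have := card_le_card_add_left (t := M) (card_pos.1 hX1)
    omega

open Finset in
/-- A Vosper-type inequality for generating Sidon sets. -/
theorem sidon_vosper {G : Type*} [AddCommGroup G] [Fintype G] [DecidableEq G]
    {M : Finset G} (hM : ∀ g : G, g ≠ 0 → #(M ∩ (g +ᵥ M)) ≤ 1) (h0 : 0 ∈ M)
    (hgen : AddSubgroup.closure (M : Set G) = ⊤) (hM3 : 3 ≤ #M) {Y : Finset G} (hY : 2 ≤ #Y)
    (hYM : #(Y + M) + 2 ≤ Fintype.card G) : #Y + #M ≤ #(Y + M) := by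
  by_contra! hlt
  obtain ⟨X, hX2, hX0, hXM, hle, ⟨K, hK⟩ | hX⟩ := exists_addSubgroup_or_sidon M Y hY hYM
  · have := card_add_card_le_of_sidon_of_addSubgroup hM h0 K X hK hX2 (by
      by_contra! hc
      have hK' : K = ⊤ := top_le_iff.1 (hgen ▸ (AddSubgroup.closure_le K).2 hc)
      have : X + M = univ := eq_univ_iff_forall.2 fun z => mem_add.2 ⟨z, by
        rw [hK, hK']; trivial, 0, h0, add_zero z⟩
      rw [this, card_univ] at hXM
      omega)
    omega
  · have h1 := two_mul_card_mul_card_le_of_sidon hM X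
    have h2 := two_mul_card_mul_card_le_of_sidon hX M
    rw [add_comm M X] at h2
    have h3 : #(X + M) + 1 ≤ #X + #M := by omega
    generalize #X = s at *
    generalize #M = m at *
    generalize #(X + M) = t at *
    obtain ⟨s, rfl⟩ := Nat.exists_eq_add_of_le hX2
    obtain ⟨m, rfl⟩ := Nat.exists_eq_add_of_le hM3
    rcases le_total s (m + 1) with h | h
    · nlinarith
    · nlinarith

open Finset in
theorem card_add_card_le_of_notMem_add {G : Type*} [AddCommGroup G] [Fintype G] [DecidableEq G]
    {S T : Finset G} {x : G} (hx : x ∉ S + T) : #S + #T ≤ Fintype.card G := by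
  have hd : Disjoint S (T.image (x - ·)) := by
    rw [disjoint_left]
    intro s hs hs'
    obtain ⟨t, ht, rfl⟩ := mem_image.1 hs'
    exact hx (mem_add.2 ⟨_, hs, t, ht, by abel⟩)
  have := card_le_univ (S ∪ T.image (x - ·))
  rwa [card_union_of_disjoint hd, card_image_of_injective _ sub_right_injective] at this

open Finset in
theorem exists_critical_of_nsmul_ne_univ {G : Type*} [AddCommGroup G] [Fintype G] [DecidableEq G]
    {A : Finset G} {n : ℕ} (hA : 2 ≤ #A) (hbig : Fintype.card G < n * #A)
    (hne : n • A ≠ univ) :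
    ∃ Y : Finset G, 2 ≤ #Y ∧ #(Y + A) + 2 ≤ Fintype.card G ∧ #(Y + A) < #Y + #A := by
  by_contra! hcon
  obtain ⟨x, hx⟩ : ∃ x, x ∉ n • A := by simpa [eq_univ_iff_forall] using hne
  obtain ⟨n, rfl⟩ := Nat.exists_eq_add_of_lt (Nat.pos_of_mul_pos_right (by omega : 0 < n * #A))
  rw [zero_add] at *
  rw [succ_nsmul] at hx
  have hsum := card_add_card_le_of_notMem_add hx
  have hAne : A.Nonempty := card_pos.1 (by omega)
  have hmono : Monotone fun k : ℕ => #(k • A) := monotone_nat_of_le_succ fun k => by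
    rw [succ_nsmul]; exact card_le_card_add_right hAne
  have key : ∀ k, k ≤ n → k * #A ≤ #(k • A) := fun k => by
    induction k with
    | zero => simp
    | succ k ih =>
      intro hk
      have h1 := ih (by omega)
      have h2 : #((k + 1) • A) ≤ #(n • A) := hmono hk
      rcases Nat.eq_zero_or_pos k with rfl | hk0
      · simp
      rw [succ_nsmul] at *
      have h3 : #A ≤ k * #A := Nat.le_mul_of_pos_left _ hk0
      have := hcon (k • A) (by omega) (by omega)
      rw [add_mul]
      omega
  have := key n le_rfl
  rw [add_mul] at hbig
  omega

open Finset in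
theorem univ_add_of_nonempty {G : Type*} [AddGroup G] [Fintype G] [DecidableEq G]
    {A : Finset G} (hA : A.Nonempty) : univ + A = univ := by
  obtain ⟨a, ha⟩ := hA
  exact eq_univ_iff_forall.2 fun z => mem_add.2 ⟨z - a, mem_univ _, a, ha, sub_add_cancel z a⟩

open Finset in
theorem nsmul_eq_univ_of_card_le {G : Type*} [AddCommGroup G] [Fintype G] [DecidableEq G]
    {A : Finset G} (hA : A.Nonempty)
    (hgen : AddSubgroup.closure ((A : Set G) - (A : Set G)) = ⊤) {n : ℕ}
    (hn : Fintype.card G ≤ n) : n • A = univ := by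
  have key : ∀ k : ℕ, k • A = univ ∨ k + 1 ≤ #(k • A) := fun k => by
    induction k with
    | zero => simp
    | succ k ih =>
      by_cases hle : #(k • A + A) ≤ #(k • A)
      · left
        have heq : ∀ a ∈ A, a +ᵥ (k • A) = k • A + A := fun a ha => by
          refine eq_of_subset_of_card_le (fun z hz => ?_) (by rwa [card_vadd_finset])
          obtain ⟨y, hy, rfl⟩ := mem_vadd_finset.1 hz
          exact mem_add.2 ⟨y, hy, a, ha, add_comm y a⟩
        have hstab : AddAction.stabilizer G (k • A) = ⊤ := by
          rw [← top_le_iff, ← hgen, AddSubgroup.closure_le]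
          rintro _ ⟨a, ha, b, hb, rfl⟩
          rw [SetLike.mem_coe, AddAction.mem_stabilizer_iff]
          change (a - b) +ᵥ (k • A) = k • A
          rw [sub_eq_neg_add, add_vadd, heq a ha, ← heq b hb, neg_vadd_vadd]
        obtain ⟨x, hx⟩ : (k • A).Nonempty := hA.nsmul
        have huniv : k • A = univ := eq_univ_iff_forall.2 fun z => by
          have h : (z - x) +ᵥ (k • A) = k • A :=
            AddAction.mem_stabilizer_iff.1 (hstab ▸ AddSubgroup.mem_top (z - x))
          rw [← h]
          exact mem_vadd_finset.2 ⟨x, hx, by simp⟩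
        rw [succ_nsmul, huniv, univ_add_of_nonempty hA]
      · rcases ih with h | h
        · left
          rw [succ_nsmul, h, univ_add_of_nonempty hA]
        · right
          rw [succ_nsmul]
          omega
  refine (key n).resolve_right fun h => ?_
  have := card_le_univ (n • A)
  omega

open Finset in
theorem sidon_coset_slice {G : Type*} [AddCommGroup G] [Fintype G] [DecidableEq G]
    {M : Finset G} (hM : ∀ g : G, g ≠ 0 → #(M ∩ (g +ᵥ M)) ≤ 1) (h0 : 0 ∈ M)
    {H : AddSubgroup G} (hH : H = AddSubgroup.closure (M : Set G)) {B : Finset G} {c : G}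
    (hc : c ∈ B) (hB : ∀ b ∈ B, b - c ∈ H) :
    (∀ h ∈ H, c + h ∈ B + M) ∨ #B + #M ≤ #(B + M) + 1 := by
  classical
  have hMH : ∀ m ∈ M, m ∈ H := fun m hm => hH ▸ AddSubgroup.subset_closure hm
  let M' : Finset H := univ.filter fun h => (h : G) ∈ M
  let Y : Finset H := univ.filter fun h => c + (h : G) ∈ B
  have hM' : M'.image H.subtype = M := by
    ext z
    simp only [M', mem_image, mem_filter, mem_univ, true_and, AddSubgroup.coe_subtype]
    exact ⟨by rintro ⟨h, hh, rfl⟩; exact hh, fun hz => ⟨⟨z, hMH z hz⟩, hz, rfl⟩⟩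
  have hY' : c +ᵥ Y.image H.subtype = B := by
    ext z
    simp only [Y, mem_vadd_finset, mem_image, mem_filter, mem_univ, true_and,
      AddSubgroup.coe_subtype, vadd_eq_add]
    constructor
    · rintro ⟨_, ⟨h, hh, rfl⟩, rfl⟩
      exact hh
    · exact fun hz => ⟨z - c, ⟨⟨z - c, hB z hz⟩, by simpa using hz, rfl⟩, by abel⟩
  have hYM : c +ᵥ (Y + M').image H.subtype = B + M := by
    rw [image_add, hM', ← vadd_add_assoc, hY']
  have cM : #M' = #M := by
    rw [← hM', card_image_of_injective _ H.subtype_injective]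
  have cY : #Y = #B := by
    rw [← hY', card_vadd_finset, card_image_of_injective _ H.subtype_injective]
  have cYM : #(Y + M') = #(B + M) := by
    rw [← hYM, card_vadd_finset, card_image_of_injective _ H.subtype_injective]
  by_cases hu : Y + M' = univ
  · left
    intro h hh
    rw [← hYM, hu]
    exact mem_vadd_finset.2 ⟨h, mem_image.2 ⟨⟨h, hh⟩, mem_univ _, rfl⟩, rfl⟩
  · right
    rw [← cM, ← cY, ← cYM]
    refine sidon_card_add (fun g hg => ?_) ?_ ?_ ⟨0, by simpa [Y] using hc⟩ hu
    · rw [← card_image_of_injective _ H.subtype_injective]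
      refine (card_le_card ?_).trans (hM g (by simpa using hg))
      intro z hz
      obtain ⟨y, hy, rfl⟩ := mem_image.1 hz
      obtain ⟨h1, h2⟩ := mem_inter.1 hy
      obtain ⟨w, hw, rfl⟩ := mem_vadd_finset.1 h2
      refine mem_inter.2 ⟨by simpa [M'] using h1, mem_vadd_finset.2 ⟨w, by simpa [M'] using hw, rfl⟩⟩
    · simpa [M'] using h0
    · subst hH
      have hpre : (M' : Set (AddSubgroup.closure (M : Set G))) = Subtype.val ⁻¹' (M : Set G) := by
        ext z
        simp [M']
      rw [hpre, AddSubgroup.closure_closure_coe_preimage]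

open Finset in
theorem card_add_lt_of_sidon {G : Type*} [AddCommGroup G] [Fintype G] [DecidableEq G]
    {M : Finset G} (hM : ∀ g : G, g ≠ 0 → #(M ∩ (g +ᵥ M)) ≤ 1) (h0 : 0 ∈ M)
    {H : AddSubgroup G} (hH : H = AddSubgroup.closure (M : Set G)) {X : Finset G}
    (hX : ∀ z, z ∈ X ↔ z ∈ H) {A : Finset G} (hAM : #(A + M) < #A + #M) :
    #(A + X) < #A + #X := by
  classical
  have hMH : ∀ m ∈ M, m ∈ H := fun m hm => hH ▸ AddSubgroup.subset_closure hm
  have hMX : #M ≤ #X := card_le_card fun m hm => (hX m).2 (hMH m hm)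
  by_cases hall : ∀ c ∈ A, ∀ h ∈ H, c + h ∈ A + M
  · have : A + X ⊆ A + M := by
      intro z hz
      obtain ⟨a, ha, x, hx, rfl⟩ := mem_add.1 hz
      exact hall a ha x ((hX x).1 hx)
    have := card_le_card this
    omega
  push Not at hall
  obtain ⟨c, hc, h, hh, hch⟩ := hall
  let B := A.filter fun a => a - c ∈ H
  let R := A.filter fun a => a - c ∉ H
  have hcB : c ∈ B := by simp [B, hc]
  have hBR : #B + #R = #A := card_filter_add_card_filter_not _
  have hB := (sidon_coset_slice hM h0 hH hcB (fun b hb => (mem_filter.1 hb).2)).resolve_left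
    fun hB => hch (add_subset_add_right (filter_subset _ _) (hB h hh))
  have hd : Disjoint (B + M) (R + M) := by
    rw [disjoint_left]
    intro z hz hz'
    obtain ⟨b, hb, m, hm, rfl⟩ := mem_add.1 hz
    obtain ⟨r, hr, m', hm', he⟩ := mem_add.1 hz'
    refine (mem_filter.1 hr).2 ?_
    have : r - c = (b - c) + m - m' := by
      rw [sub_add_eq_add_sub, ← he]; abel
    rw [this]
    exact H.sub_mem (H.add_mem (mem_filter.1 hb).2 (hMH m hm)) (hMH m' hm')
  have hu : #(B + M) + #(R + M) ≤ #(A + M) := by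
    rw [← card_union_of_disjoint hd]
    exact card_le_card (union_subset (add_subset_add_right (filter_subset _ _))
      (add_subset_add_right (filter_subset _ _)))
  have hRM : R = R + M := eq_of_subset_of_card_le
    (fun r hr => mem_add.2 ⟨r, hr, 0, h0, add_zero r⟩) (by omega)
  have hstab : H ≤ AddAction.stabilizer G R := by
    rw [hH, AddSubgroup.closure_le]
    intro m hm
    rw [SetLike.mem_coe, AddAction.mem_stabilizer_iff]
    refine eq_of_subset_of_card_le (fun z hz => ?_) (card_vadd_finset m R).ge
    obtain ⟨r, hr, rfl⟩ := mem_vadd_finset.1 hz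
    rw [hRM]
    exact mem_add.2 ⟨r, hr, m, hm, add_comm r m⟩
  have hsub : A + X ⊆ R ∪ (c +ᵥ X) := by
    intro z hz
    obtain ⟨a, ha, x, hx, rfl⟩ := mem_add.1 hz
    rw [mem_union]
    by_cases hac : a - c ∈ H
    · right
      exact mem_vadd_finset.2 ⟨a - c + x, (hX _).2 (H.add_mem hac ((hX x).1 hx)), by
        rw [vadd_eq_add]; abel⟩
    · left
      rw [← AddAction.mem_stabilizer_iff.1 (hstab ((hX x).1 hx))]
      exact mem_vadd_finset.2 ⟨a, mem_filter.2 ⟨ha, hac⟩, add_comm x a⟩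
  have h1 := card_le_card hsub
  have h2 := card_union_le R (c +ᵥ X)
  rw [card_vadd_finset] at h2
  have h3 : 0 < #B := card_pos.2 ⟨c, hcB⟩
  omega

open Finset in
/-- If `n • A` is not everything, then some nontrivial proper subgroup `H` is such that `A` misses
fewer than `#H` elements of `A + H`. -/
theorem exists_addSubgroup_card_add_lt {G : Type*} [AddCommGroup G] [Fintype G] [DecidableEq G]
    {A : Finset G} (hA : 2 ≤ #A)
    (hgen : AddSubgroup.closure ((A : Set G) - (A : Set G)) = ⊤) {n : ℕ}
    (hn : AddMonoid.exponent G ≤ n) (hbig : Fintype.card G < n * #A) (hne : n • A ≠ univ) :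
    ∃ (H : AddSubgroup G) (X : Finset G), (∀ z, z ∈ X ↔ z ∈ H) ∧ 2 ≤ #X ∧ H ≠ ⊤ ∧
      #(A + X) < #A + #X := by
  classical
  have hAne : A.Nonempty := card_pos.1 (by omega)
  obtain ⟨Y, hY, hYA, hlt⟩ := exists_critical_of_nsmul_ne_univ hA hbig hne
  obtain ⟨M, hM2, hM0, hMA, hle, ⟨K, hK⟩ | hM⟩ := exists_addSubgroup_or_sidon A Y hY hYA
  · refine ⟨K, M, hK, hM2, ?_, by rw [add_comm]; omega⟩
    rintro rfl
    have : M = univ := eq_univ_iff_forall.2 fun z => (hK z).2 trivial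
    rw [this, univ_add_of_nonempty hAne, card_univ] at hMA
    omega
  · rw [add_comm M A] at hle hMA
    refine ⟨AddSubgroup.closure (M : Set G),
      univ.filter (· ∈ AddSubgroup.closure (M : Set G)), by simp, ?_, ?_,
      card_add_lt_of_sidon hM hM0 rfl (by simp) (by omega)⟩
    · exact hM2.trans (card_le_card fun m hm => by
        simpa using AddSubgroup.subset_closure (k := (M : Set G)) hm)
    · intro htop
      rcases hM2.lt_or_eq with h3 | h3
      · have := sidon_vosper hM hM0 htop h3 hA hMA
        omega
      · obtain ⟨d, hd⟩ := card_eq_one.1 (by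
          rw [card_erase_of_mem hM0, ← h3] : #(M.erase 0) = 1)
        have hcyc : IsAddCyclic G := ⟨d, fun z => by
          have hz : z ∈ AddSubgroup.closure (M : Set G) := htop ▸ AddSubgroup.mem_top z
          rw [← insert_erase hM0, hd, coe_insert, coe_singleton,
            AddSubgroup.closure_insert_zero] at hz
          rwa [← AddSubgroup.zmultiples_eq_closure] at hz⟩
        rw [IsAddCyclic.exponent_eq_card, Nat.card_eq_fintype_card] at hn
        exact hne (nsmul_eq_univ_of_card_le hAne hgen hn)

open Finset in
theorem mem_nsmul_dichotomy {G : Type*} [AddCommGroup G] [DecidableEq G] {S : Finset G} (a : G)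
    {k : ℕ} {y : G} (hy : y ∈ k • S) :
    y = k • a ∨ ∃ b ∈ S, b ≠ a ∧ ∃ j, k = j + 1 ∧ ∃ z ∈ j • S, y = b + z := by
  induction k generalizing y with
  | zero => left; simpa using hy
  | succ k ih =>
    rw [succ_nsmul] at hy
    obtain ⟨y, hyk, s, hs, rfl⟩ := mem_add.1 hy
    by_cases hsa : s = a
    · subst hsa
      rcases ih hyk with rfl | ⟨b, hb, hba, j, rfl, z, hz, rfl⟩
      · exact .inl (succ_nsmul s k).symm
      · exact .inr ⟨b, hb, hba, j + 1, rfl, z + s, by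
          rw [succ_nsmul]; exact add_mem_add hz hs, add_assoc b z s⟩
    · exact .inr ⟨s, hs, hsa, k, rfl, y, hyk, add_comm y s⟩

open Finset in
theorem card_slice_add_card_slice_le {G : Type*} [AddCommGroup G] [DecidableEq G]
    {A X : Finset G} {H : AddSubgroup G} [DecidablePred (· ∈ H)] (hX : ∀ z, z ∈ X ↔ z ∈ H)
    {a b c x : G} (hx : x - c - (a + b) ∈ H) (hxA : ∀ u ∈ A, ∀ v ∈ A, u + v + c ≠ x) :
    #(A.filter (· - a ∈ H)) + #(A.filter (· - b ∈ H)) ≤ #X := by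
  have hd : Disjoint (A.filter (· - a ∈ H)) ((A.filter (· - b ∈ H)).image (x - c - ·)) := by
    rw [disjoint_left]
    intro s hs hs'
    obtain ⟨t, ht, rfl⟩ := mem_image.1 hs'
    exact hxA _ (mem_filter.1 hs).1 t (mem_filter.1 ht).1 (by abel)
  rw [← card_image_of_injective (A.filter (· - b ∈ H)) (sub_right_injective (b := x - c)),
    ← card_union_of_disjoint hd, ← card_vadd_finset a X]
  refine card_le_card (union_subset (fun z hz => ?_) fun z hz => ?_)
  · exact mem_vadd_finset.2 ⟨z - a, (hX _).2 (mem_filter.1 hz).2, by simp⟩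
  · obtain ⟨t, ht, rfl⟩ := mem_image.1 hz
    refine mem_vadd_finset.2 ⟨x - c - t - a, (hX _).2 ?_, by simp⟩
    have : x - c - t - a = x - c - (a + b) - (t - b) := by abel
    rw [this]
    exact H.sub_mem hx (mem_filter.1 ht).2

open Finset in
theorem lt_card_slice_add_card_slice {G : Type*} [AddCommGroup G] [DecidableEq G]
    {A X : Finset G} {H : AddSubgroup G} [DecidablePred (· ∈ H)] (hX : ∀ z, z ∈ X ↔ z ∈ H)
    (hlt : #(A + X) < #A + #X) {a b : G} (ha : a ∈ A) (hb : b ∈ A) (hab : a - b ∉ H) :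
    #X < #(A.filter (· - a ∈ H)) + #(A.filter (· - b ∈ H)) := by
  have hd : Disjoint (a +ᵥ X) (b +ᵥ X) := by
    rw [disjoint_left]
    intro z hz hz'
    obtain ⟨u, hu, rfl⟩ := mem_vadd_finset.1 hz
    obtain ⟨v, hv, he⟩ := mem_vadd_finset.1 hz'
    rw [vadd_eq_add, vadd_eq_add] at he
    refine hab ?_
    have : a - b = v - u := by rw [sub_eq_sub_iff_add_eq_add, ← he, add_comm]
    rw [this]
    exact H.sub_mem ((hX v).1 hv) ((hX u).1 hu)
  have h1 : A ∪ ((a +ᵥ X) ∪ (b +ᵥ X)) ⊆ A + X := by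
    refine union_subset (fun z hz => mem_add.2 ⟨z, hz, 0, (hX 0).2 H.zero_mem, add_zero z⟩)
      (union_subset ?_ ?_)
    all_goals
      intro z hz
      obtain ⟨u, hu, rfl⟩ := mem_vadd_finset.1 hz
      exact add_mem_add (by assumption) hu
  have h2 : A ∩ ((a +ᵥ X) ∪ (b +ᵥ X)) ⊆ A.filter (· - a ∈ H) ∪ A.filter (· - b ∈ H) := by
    intro z hz
    obtain ⟨hzA, hz⟩ := mem_inter.1 hz
    refine mem_union.2 ((mem_union.1 hz).imp ?_ ?_)
    all_goals
      intro h
      obtain ⟨u, hu, rfl⟩ := mem_vadd_finset.1 h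
      exact mem_filter.2 ⟨hzA, by simpa using (hX u).1 hu⟩
  have h3 := card_union_add_card_inter A ((a +ᵥ X) ∪ (b +ᵥ X))
  have h4 := card_le_card h1
  have h5 := (card_le_card h2).trans (card_union_le _ _)
  rw [card_union_of_disjoint hd, card_vadd_finset, card_vadd_finset] at h3
  omega

open Finset in
theorem card_lt_mul_card_image_mk {G : Type*} [AddCommGroup G] [Fintype G] [DecidableEq G]
    {A X : Finset G} {H : AddSubgroup G} [Fintype (G ⧸ H)] [DecidableEq (G ⧸ H)]
    (hX : ∀ z, z ∈ X ↔ z ∈ H) {n : ℕ} (hbig : Fintype.card G < n * #A) :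
    Fintype.card (G ⧸ H) < n * #(A.image (QuotientAddGroup.mk' H)) := by
  have h1 : Fintype.card G = Fintype.card (G ⧸ H) * #X := by
    rw [← Nat.card_eq_fintype_card, ← Nat.card_eq_fintype_card,
      AddSubgroup.card_eq_card_quotient_mul_card_addSubgroup H]
    congr 1
    exact Nat.subtype_card X hX
  have h2 : #A ≤ #X * #(A.image (QuotientAddGroup.mk' H)) := by
    refine card_le_mul_card_image A _ fun b hb => ?_
    obtain ⟨a, ha, rfl⟩ := mem_image.1 hb
    rw [← card_vadd_finset a X]
    refine card_le_card fun z hz => mem_vadd_finset.2 ⟨-a + z, (hX _).2 ?_, by simp⟩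
    exact QuotientAddGroup.eq.1 (mem_filter.1 hz).2.symm
  rw [h1] at hbig
  refine Nat.lt_of_mul_lt_mul_right (a := #X) (hbig.trans_le ?_)
  nlinarith

open Finset in
theorem mem_nsmul_of_quotient {G : Type*} [AddCommGroup G] [Fintype G] [DecidableEq G]
    {A X : Finset G} {H : AddSubgroup G} [DecidableEq (G ⧸ H)]
    (hX : ∀ z, z ∈ X ↔ z ∈ H) (hlt : #(A + X) < #A + #X) {n : ℕ} (hn2 : 2 ≤ n)
    (hn : AddMonoid.exponent G ≤ n) {a b : G} (ha : a ∈ A) (hb : b ∈ A) (hab : a - b ∉ H)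
    {x : G} (hx : (x : G ⧸ H) ∈ n • A.image (QuotientAddGroup.mk' H)) : x ∈ n • A := by
  classical
  obtain ⟨n, rfl⟩ := Nat.exists_eq_add_of_le' hn2
  by_contra hxA
  have hpair : ∀ u ∈ A, ∀ v ∈ A, ∀ c ∈ n • A, x - c - (u + v) ∈ H →
      #(A.filter (· - u ∈ H)) + #(A.filter (· - v ∈ H)) ≤ #X := fun u hu v hv c hc h =>
    card_slice_add_card_slice_le hX h fun s hs t ht he => hxA <| by
      rw [← he, add_nsmul, two_nsmul, add_comm]
      exact add_mem_add (add_mem_add hs ht) hc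
  have hmix : ∀ u ∈ A, ∀ v ∈ A, ∀ c ∈ n • A, u - v ∉ H → x - c - (u + v) ∉ H :=
    fun u hu v hv c hc huv h =>
      (lt_card_slice_add_card_slice hX hlt hu hv huv).not_ge (hpair u hu v hv c hc h)
  have hconst : ∀ u ∈ A, x - (n + 2) • u ∈ H →
      2 * #(A.filter (· - u ∈ H)) ≤ #X := fun u hu h => by
    rw [two_mul]
    refine hpair u hu u hu (n • u) (nsmul_mem_nsmul hu) ?_
    have : x - n • u - (u + u) = x - (n + 2) • u := by rw [add_nsmul, two_nsmul, sub_sub]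
    rwa [this]
  obtain ⟨u, hu, hxu⟩ : ∃ u ∈ A, x - (n + 2) • u ∈ H := by
    rw [show n + 2 = (n + 1) + 1 from rfl, succ_nsmul] at hx
    obtain ⟨y, hy, s, hs, hys⟩ := mem_add.1 hx
    obtain ⟨u, hu, rfl⟩ := mem_image.1 hs
    refine ⟨u, hu, ?_⟩
    rcases mem_nsmul_dichotomy (QuotientAddGroup.mk' H u) hy with
      rfl | ⟨s, hs, hsu, j, hj, z, hz, rfl⟩
    · rw [← succ_nsmul, ← map_nsmul] at hys
      rw [← neg_add_eq_sub]
      exact QuotientAddGroup.eq.1 hys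
    · obtain rfl : n = j := by omega
      obtain ⟨v, hv, rfl⟩ := mem_image.1 hs
      rw [← image_nsmul] at hz
      obtain ⟨c, hc, rfl⟩ := mem_image.1 hz
      refine absurd ?_ (hmix v hv u hu c hc fun h => hsu ?_)
      · rw [← map_add, ← map_add] at hys
        have : x - c - (v + u) = -(v + c + u) + x := by abel
        rw [this]
        exact QuotientAddGroup.eq.1 hys
      · rw [← sub_eq_zero, ← map_sub]
        exact (QuotientAddGroup.eq_zero_iff _).2 h
  obtain ⟨v, hv, huv⟩ : ∃ v ∈ A, u - v ∉ H := by
    by_contra! h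
    refine hab ?_
    rw [← sub_sub_sub_cancel_left b a u]
    exact H.sub_mem (h b hb) (h a ha)
  have he : 0 < AddMonoid.exponent G := AddMonoid.ExponentExists.of_finite.exponent_pos
  obtain ⟨e, he'⟩ := Nat.exists_eq_add_of_lt he
  rw [zero_add] at he'
  have hev : (e + 1) • v = 0 := he' ▸ AddMonoid.exponent_nsmul_eq_zero v
  have heu : (e + 1) • u = 0 := he' ▸ AddMonoid.exponent_nsmul_eq_zero u
  rw [he'] at hn
  rcases (show e + 1 = n + 2 ∨ e ≤ n by omega) with h | h
  · have h1 := hconst u hu hxu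
    have h2 := hconst v hv (by rwa [← h, hev, ← heu, h])
    have h3 := lt_card_slice_add_card_slice hX hlt hu hv huv
    omega
  · obtain ⟨k, rfl⟩ := Nat.exists_eq_add_of_le h
    refine hmix u hu v hv (e • v + k • u) ?_ huv ?_
    · rw [add_nsmul]
      exact add_mem_add (nsmul_mem_nsmul hv) (nsmul_mem_nsmul hu)
    · have h1 : x - (e • v + k • u) - (u + v) = x - (k • u + u) - (e + 1) • v := by
        rw [succ_nsmul]; abel
      have h2 : (e + k + 2) • u = k • u + u + (e + 1) • u := by
        rw [← succ_nsmul, ← add_nsmul]; congr 1; omega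
      rwa [h1, hev, ← heu, sub_sub, ← h2]

theorem stmt_11 {G : Type*} [AddCommGroup G] [Fintype G] [DecidableEq G]
    (A : Finset G) (hA : A.Nonempty)
    (hgen : AddSubgroup.closure ((A : Set G) - (A : Set G)) = ⊤)
    (n : ℕ) (hn1 : 1 ≤ n) (hn : AddMonoid.exponent G ≤ n)
    (hbig : Fintype.card G < n * A.card) :
    n • A = Finset.univ := by
  induction hN : Fintype.card G using Nat.strong_induction_on generalizing G with
  | _ N ih =>
  subst hN
  classical
  by_contra hne
  have hn2 : 2 ≤ n := by
    rcases hn1.lt_or_eq with h | rfl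
    · exact h
    · have := A.card_le_univ
      omega
  have hA2 : 2 ≤ A.card := by
    by_contra! hlt
    obtain ⟨a, rfl⟩ := Finset.card_eq_one.1 (by have := hA.card_pos; omega : A.card = 1)
    rw [Finset.coe_singleton, Set.singleton_sub_singleton, sub_self,
      AddSubgroup.closure_singleton_zero] at hgen
    have : Subsingleton G := AddSubgroup.subsingleton_iff.1 (subsingleton_of_bot_eq_top hgen)
    exact hne ((hA.nsmul (n := n)).eq_univ)
  obtain ⟨H, X, hX, hX2, hH, hlt⟩ := exists_addSubgroup_card_add_lt hA2 hgen hn hbig hne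
  obtain ⟨a, ha, b, hb, hab⟩ : ∃ a ∈ A, ∃ b ∈ A, a - b ∉ H := by
    by_contra! h
    refine hH (top_le_iff.1 (hgen ▸ (AddSubgroup.closure_le H).2 ?_))
    rintro _ ⟨a, ha, b, hb, rfl⟩
    exact h a ha b hb
  have : Fintype (G ⧸ H) := Fintype.ofFinite _
  have hsurj := QuotientAddGroup.mk'_surjective H
  have hcard : Fintype.card (G ⧸ H) < Fintype.card G := by
    refine Fintype.card_lt_of_surjective_not_injective _ hsurj fun hinj => ?_
    obtain ⟨u, hu, hu0⟩ := Finset.exists_mem_ne (s := X) (by omega) 0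
    refine hu0 (hinj ?_)
    rw [map_zero]
    exact (QuotientAddGroup.eq_zero_iff u).2 ((hX u).1 hu)
  have hquot := ih _ hcard (A.image (QuotientAddGroup.mk' H)) (hA.image _) (by
      rw [Finset.coe_image, ← Set.image_sub, ← AddMonoidHom.map_closure, hgen,
        AddSubgroup.map_top_of_surjective _ hsurj])
    ((Nat.le_of_dvd AddMonoid.ExponentExists.of_finite.exponent_pos
      (AddMonoidHom.exponent_dvd hsurj)).trans hn)
    (card_lt_mul_card_image_mk hX hbig) rfl
  exact hne (Finset.eq_univ_iff_forall.2 fun x =>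
    mem_nsmul_of_quotient hX hlt hn2 hn ha hb hab (hquot ▸ Finset.mem_univ _))
end

section
/- Let G be a finite abelian group with exp(G) prime, let A ⊆ G be a nonempty subset with ⟨A⟩_* = G, and let n = exp(G) − 1. If n·|A| > |G| and n ≥ 1, then nA = G. -/
open Pointwise

/-- If `a + g` and `b + g` are distinct nonzero points of the same line through the origin, then `g`
is a sum of `p - 1` elements of `{a, b}`. -/
lemma exists_nsmul_add_nsmul_eq {p : ℕ} [Fact p.Prime] {G : Type*} [AddCommGroup G]
    [Module (ZMod p) G] {a b g : G} (hab : a ≠ b) {c : ZMod p} (hc : b + g = c • (a + g)) :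
    ∃ i j : ℕ, i + j = p - 1 ∧ i • a + j • b = g := by
  have hc1 : c - 1 ≠ 0 := by
    intro h
    rw [sub_eq_zero.1 h, one_smul] at hc
    exact hab (add_right_cancel hc).symm
  set t : ZMod p := (c - 1)⁻¹ with ht
  have hlt := ZMod.val_lt t
  refine ⟨p - 1 - t.val, t.val, by omega, ?_⟩
  have hcast : ((p - 1 - t.val : ℕ) : ZMod p) = -1 - t := by
    rw [Nat.cast_sub (by omega), Nat.cast_sub (by omega)]
    simp
  have hline : t • (b - a) = a + g := by
    have h : b - a = (c - 1) • (a + g) := by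
      rw [sub_smul, one_smul, ← hc]
      abel
    rw [h, smul_smul, ht, inv_mul_cancel₀ hc1, one_smul]
  rw [← Nat.cast_smul_eq_nsmul (ZMod p), ← Nat.cast_smul_eq_nsmul (ZMod p), hcast,
    ZMod.natCast_zmod_val, eq_sub_of_add_eq' hline.symm]
  module

/-- In a finite vector space over `ZMod p`, a set with more than `|G| / (p - 1)` elements has
`(p - 1)`-fold sumset equal to the whole space. -/
lemma nsmul_eq_univ_of_card_lt {p : ℕ} [Fact p.Prime] {G : Type*} [AddCommGroup G] [Fintype G]
    [DecidableEq G] [Module (ZMod p) G] {A : Finset G} (hA : Fintype.card G < (p - 1) * A.card) :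
    (p - 1) • A = Finset.univ := by
  have hmem {a b : G} (ha : a ∈ A) (hb : b ∈ A) {i j : ℕ} (hij : i + j = p - 1) :
      i • a + j • b ∈ (p - 1) • A := by
    rw [← hij, add_nsmul]
    exact Finset.add_mem_add (Finset.nsmul_mem_nsmul ha) (Finset.nsmul_mem_nsmul hb)
  refine Finset.eq_univ_of_forall fun g ↦ ?_
  obtain ⟨⟨u, a⟩, hx, ⟨v, b⟩, hy, hne, heq⟩ :=
    Finset.exists_ne_map_eq_of_card_lt_of_maps_to
      (s := (Finset.univ : Finset (ZMod p)ˣ) ×ˢ A) (t := (Finset.univ : Finset G))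
      (f := fun x ↦ (x.1 : ZMod p) • (x.2 + g))
      (by simpa [Finset.card_product, Nat.totient_prime (Fact.out : p.Prime)] using hA) (by simp [Set.MapsTo])
  have ha : a ∈ A := (Finset.mem_product.1 hx).2
  have hb : b ∈ A := (Finset.mem_product.1 hy).2
  dsimp only at heq
  by_cases hab : a = b
  · subst hab
    have huv : (u : ZMod p) - v ≠ 0 := fun h ↦ hne (by rw [Units.ext (sub_eq_zero.1 h)])
    have hag : a + g = 0 := by
      refine (smul_eq_zero.1 ?_).resolve_left huv
      rw [sub_smul, heq, sub_self]
    convert hmem ha ha (add_zero (p - 1)) using 1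
    rw [zero_nsmul, add_zero, ← Nat.cast_smul_eq_nsmul (ZMod p),
      Nat.cast_sub (Fact.out : p.Prime).one_le]
    simpa using eq_neg_of_add_eq_zero_right hag
  · obtain ⟨i, j, hij, rfl⟩ := exists_nsmul_add_nsmul_eq (p := p) (g := g) hab
      (c := (v : ZMod p)⁻¹ * u)
      (by rw [mul_smul, heq, smul_smul, inv_mul_cancel₀ v.ne_zero, one_smul])
    exact hmem ha hb hij

theorem stmt_12 {G : Type*} [AddCommGroup G] [Fintype G] [DecidableEq G]
    (hprime : (AddMonoid.exponent G).Prime)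
    (A : Finset G) (hA : A.Nonempty)
    (hgen : AddSubgroup.closure ((A : Set G) - (A : Set G)) = ⊤)
    (n : ℕ) (hn : n = AddMonoid.exponent G - 1) (hn1 : 1 ≤ n)
    (hbig : Fintype.card G < n * A.card) :
    n • A = Finset.univ := by
  have : Fact (AddMonoid.exponent G).Prime := ⟨hprime⟩
  let : Module (ZMod (AddMonoid.exponent G)) G :=
    AddCommGroup.zmodModule AddMonoid.exponent_nsmul_eq_zero
  subst hn
  exact nsmul_eq_univ_of_card_lt hbig
end

section
/- Let G be a finite abelian group, n ≥ exp(G), and let S be a finite sequence over G with |S| ≥ n + |G| − 1 and maximum multiplicity h(S) ≤ n. Suppose that for every proper subgroup H < G and every α ∈ G, at least |G/H| − 1 terms of S lie outside the coset α + H. Then Σ_n(S) = G. -/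
namespace SubseqSum

open Finset
open scoped Classical Pointwise

universe u

section Periods

variable {G : Type u} [AddCommGroup G]

/-- The stabilizer (group of periods) of a finite subset of `G`. -/
def stab (A : Finset G) : AddSubgroup G where
  carrier := {g | ∀ x, g + x ∈ A ↔ x ∈ A}
  zero_mem' := by simp
  add_mem' := by
    intro a b ha hb x
    rw [add_assoc]
    exact (ha _).trans (hb _)
  neg_mem' := by
    intro a ha x
    simpa using (ha (-a + x)).symm

theorem mem_stab {A : Finset G} {g : G} : g ∈ stab A ↔ ∀ x, g + x ∈ A ↔ x ∈ A := Iff.rfl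

theorem mem_stab_of_forall {A : Finset G} {g : G} (h : ∀ x ∈ A, g + x ∈ A) : g ∈ stab A := by
  have himg : A.image (g + ·) = A :=
    Finset.eq_of_subset_of_card_le (by intro y; simp only [mem_image]; rintro ⟨x, hx, rfl⟩; exact h x hx)
      (by rw [card_image_of_injective _ (add_right_injective g)])
  intro x
  refine ⟨fun hx => ?_, h x⟩
  rw [← himg] at hx
  obtain ⟨y, hy, hxy⟩ := mem_image.1 hx
  rwa [← add_left_cancel hxy]

theorem le_stab_iff {A : Finset G} {H : AddSubgroup G} :
    H ≤ stab A ↔ ∀ h ∈ H, ∀ x ∈ A, h + x ∈ A :=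
  ⟨fun hH _ hh x hx => (hH hh x).2 hx, fun hH h hh => mem_stab_of_forall (hH h hh)⟩

theorem le_stab_union {A B : Finset G} {H : AddSubgroup G} (hA : H ≤ stab A) (hB : H ≤ stab B) :
    H ≤ stab (A ∪ B) := by
  intro h hh x
  simp only [mem_union, hA hh x, hB hh x]

theorem le_stab_inter {A B : Finset G} {H : AddSubgroup G} (hA : H ≤ stab A) (hB : H ≤ stab B) :
    H ≤ stab (A ∩ B) := by
  intro h hh x
  simp only [mem_inter, hA hh x, hB hh x]

theorem le_stab_add_left {A B : Finset G} {H : AddSubgroup G} (hA : H ≤ stab A) :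
    H ≤ stab (A + B) := by
  rw [le_stab_iff]
  intro h hh x hx
  obtain ⟨a, ha, b, hb, rfl⟩ := mem_add.1 hx
  exact mem_add.2 ⟨h + a, (hA hh a).2 ha, b, hb, by abel⟩

theorem le_stab_add_right {A B : Finset G} {H : AddSubgroup G} (hB : H ≤ stab B) :
    H ≤ stab (A + B) := by
  rw [add_comm]
  exact le_stab_add_left hB

theorem mem_singleton_add {t x : G} {A : Finset G} : x ∈ {t} + A ↔ x - t ∈ A := by
  rw [mem_add]
  constructor
  · rintro ⟨y, hy, z, hz, rfl⟩
    rw [mem_singleton] at hy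
    subst hy
    simpa using hz
  · exact fun hx => ⟨t, mem_singleton_self t, x - t, hx, by abel⟩

theorem stab_singleton_add (t : G) (A : Finset G) : stab ({t} + A) = stab A := by
  ext g
  simp only [mem_stab, mem_singleton_add]
  constructor
  · intro h x
    simpa [add_sub_assoc] using h (x + t)
  · intro h x
    simpa [add_sub_assoc] using h (x - t)

variable [Fintype G]

/-- The union of the `H`-cosets that meet `A`. -/
noncomputable def cl (H : AddSubgroup G) (A : Finset G) : Finset G :=
  univ.filter fun x => ∃ a ∈ A, x - a ∈ H

/-- The coset `a + H` as a finite set. -/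
noncomputable def coset (H : AddSubgroup G) (a : G) : Finset G :=
  univ.filter fun x => x - a ∈ H

theorem mem_cl {H : AddSubgroup G} {A : Finset G} {x : G} :
    x ∈ cl H A ↔ ∃ a ∈ A, x - a ∈ H := by simp [cl]

theorem mem_coset {H : AddSubgroup G} {a x : G} : x ∈ coset H a ↔ x - a ∈ H := by simp [coset]

theorem self_mem_coset (H : AddSubgroup G) (a : G) : a ∈ coset H a := by
  simp [mem_coset, H.zero_mem]

theorem card_coset (H : AddSubgroup G) (a : G) : #(coset H a) = Nat.card H := by
  rw [Nat.card_eq_fintype_card, ← Finset.card_univ]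
  symm
  refine Finset.card_bij (fun h _ => a + (h : G)) ?_ ?_ ?_
  · intro h _
    simp [mem_coset]
  · intro h _ h' _ e
    exact Subtype.ext (add_left_cancel e)
  · intro x hx
    exact ⟨⟨x - a, mem_coset.1 hx⟩, mem_univ _, by simp⟩

theorem subset_cl (H : AddSubgroup G) (A : Finset G) : A ⊆ cl H A := fun a ha =>
  mem_cl.2 ⟨a, ha, by simp [H.zero_mem]⟩

theorem cl_mono {H : AddSubgroup G} {A B : Finset G} (h : A ⊆ B) : cl H A ⊆ cl H B := fun _ hx =>
  let ⟨a, ha, hxa⟩ := mem_cl.1 hx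
  mem_cl.2 ⟨a, h ha, hxa⟩

theorem cl_mono_left {H K : AddSubgroup G} {A : Finset G} (h : H ≤ K) : cl H A ⊆ cl K A :=
  fun _ hx =>
  let ⟨a, ha, hxa⟩ := mem_cl.1 hx
  mem_cl.2 ⟨a, ha, h hxa⟩

theorem le_stab_cl (H : AddSubgroup G) (A : Finset G) : H ≤ stab (cl H A) := by
  rw [le_stab_iff]
  intro h hh x hx
  obtain ⟨a, ha, hxa⟩ := mem_cl.1 hx
  exact mem_cl.2 ⟨a, ha, by rw [add_sub_assoc]; exact H.add_mem hh hxa⟩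

theorem cl_subset_of_le_stab {H : AddSubgroup G} {A B : Finset G} (hAB : A ⊆ B)
    (h : H ≤ stab B) : cl H A ⊆ B := by
  intro x hx
  obtain ⟨a, ha, hxa⟩ := mem_cl.1 hx
  simpa using (h hxa a).2 (hAB ha)

theorem cl_eq_of_le_stab {H : AddSubgroup G} {A : Finset G} (h : H ≤ stab A) : cl H A = A :=
  (cl_subset_of_le_stab subset_rfl h).antisymm (subset_cl H A)

theorem cl_bot (A : Finset G) : cl ⊥ A = A := cl_eq_of_le_stab bot_le

theorem cl_cl {H K : AddSubgroup G} (h : K ≤ H) (A : Finset G) : cl H (cl K A) = cl H A :=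
  (cl_subset_of_le_stab (cl_mono_left h) (le_stab_cl H A)).antisymm (cl_mono (subset_cl K A))

theorem cl_add (H : AddSubgroup G) (A B : Finset G) : cl H (A + B) = A + cl H B := by
  refine (cl_subset_of_le_stab (add_subset_add_left (subset_cl H B))
    (le_stab_add_right (le_stab_cl H B))).antisymm ?_
  intro x hx
  obtain ⟨a, ha, y, hy, rfl⟩ := mem_add.1 hx
  obtain ⟨b, hb, hyb⟩ := mem_cl.1 hy
  exact mem_cl.2 ⟨a + b, add_mem_add ha hb, by simpa using hyb⟩

theorem coset_subset {H : AddSubgroup G} {A : Finset G} (h : H ≤ stab A) {a : G} (ha : a ∈ A) :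
    coset H a ⊆ A := by
  intro x hx
  simpa using (h (mem_coset.1 hx) a).2 ha

theorem card_dvd_of_le_stab {H : AddSubgroup G} {A : Finset G} (h : H ≤ stab A) :
    Nat.card H ∣ #A := by
  induction hn : #A using Nat.strong_induction_on generalizing A with
  | _ n ih =>
    obtain rfl | ⟨a, ha⟩ := A.eq_empty_or_nonempty
    · simp at hn; simp [← hn]
    have hsub := coset_subset h ha
    have hst : H ≤ stab (A \ coset H a) := by
      rw [le_stab_iff]
      intro g hg x hx
      rw [mem_sdiff, mem_coset] at hx ⊢
      refine ⟨(h hg x).2 hx.1, fun hc => hx.2 ?_⟩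
      rw [add_sub_assoc] at hc
      exact (H.add_mem_cancel_left hg).1 hc
    have hc := card_sdiff_add_card_eq_card hsub
    rw [card_coset] at hc
    have := Nat.card_pos (α := H)
    have := ih _ (by omega) hst rfl
    rw [← hn, ← hc]
    exact this.add (dvd_refl _)

theorem card_le_of_forall_sub_mem {H : AddSubgroup G} {A : Finset G} {a : G}
    (h : ∀ x ∈ A, x - a ∈ H) : #A ≤ Nat.card H := by
  rw [← card_coset H a]
  exact card_le_card fun x hx => mem_coset.2 (h x hx)

theorem eq_univ_of_top_le_stab {A : Finset G} (hA : A.Nonempty) (h : ⊤ ≤ stab A) : A = univ := by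
  obtain ⟨a, ha⟩ := hA
  refine eq_univ_iff_forall.2 fun x => coset_subset h ha (mem_coset.2 trivial)

end Periods

section Kneser

variable {G : Type u} [AddCommGroup G] [Fintype G]

theorem card_gap_le {H L : AddSubgroup G} (hLH : L ≤ H) (U : Finset G) {Z : Finset G}
    (hZ : Z ⊆ cl H U) : #Z + #(cl L U) ≤ #(cl H U) + #(Z ∩ cl L U) := by
  have h1 : Z ∪ cl L U ⊆ cl H U := union_subset hZ (cl_mono_left hLH)
  have := card_le_card h1
  have := card_union_add_card_inter Z (cl L U)
  omega

theorem coset_inter_cl_subset {H L : AddSubgroup G} (hLH : L ≤ H) (U : Finset G) (a : G) :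
    coset H a ∩ cl L U ⊆ cl L (U ∩ coset H a) := by
  intro x hx
  obtain ⟨hxa, hxU⟩ := mem_inter.1 hx
  obtain ⟨y, hy, hxy⟩ := mem_cl.1 hxU
  refine mem_cl.2 ⟨y, mem_inter.2 ⟨hy, mem_coset.2 ?_⟩, hxy⟩
  have := H.sub_mem (mem_coset.1 hxa) (hLH hxy)
  simpa using this

theorem cl_union (H : AddSubgroup G) (A B : Finset G) : cl H (A ∪ B) = cl H A ∪ cl H B := by
  ext x
  simp only [mem_cl, mem_union]
  constructor
  · rintro ⟨a, ha | ha, h⟩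
    exacts [Or.inl ⟨a, ha, h⟩, Or.inr ⟨a, ha, h⟩]
  · rintro (⟨a, ha, h⟩ | ⟨a, ha, h⟩)
    exacts [⟨a, Or.inl ha, h⟩, ⟨a, Or.inr ha, h⟩]

/-- The inequality of Kneser's theorem for the pair `(A, B)`. -/
def KneserIneq (A B : Finset G) : Prop :=
  #(cl (stab (A + B)) A) + #(cl (stab (A + B)) B) ≤ #(A + B) + Nat.card (stab (A + B))

theorem stab_le_of_subset_coset {H : AddSubgroup G} {A : Finset G} {a : G} (hA : A.Nonempty)
    (h : A ⊆ coset H a) : stab A ≤ H := by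
  obtain ⟨x, hx⟩ := hA
  intro g hg
  have h1 := mem_coset.1 (h ((hg x).2 hx))
  have h2 := mem_coset.1 (h hx)
  have := H.sub_mem h1 h2
  simpa using this

theorem add_subset_coset {H : AddSubgroup G} {A B : Finset G} {a b : G} (hA : A ⊆ coset H a)
    (hB : B ⊆ coset H b) : A + B ⊆ coset H (a + b) := by
  intro x hx
  obtain ⟨y, hy, z, hz, rfl⟩ := mem_add.1 hx
  rw [mem_coset, add_sub_add_comm]
  exact H.add_mem (mem_coset.1 (hA hy)) (mem_coset.1 (hB hz))

theorem le_stab_coset (H : AddSubgroup G) (a : G) : H ≤ stab (coset H a) := by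
  rw [le_stab_iff]
  intro h hh x hx
  rw [mem_coset, add_sub_assoc]
  exact H.add_mem hh (mem_coset.1 hx)

theorem disjoint_coset {H : AddSubgroup G} {C F : Finset G} (hC : C ⊆ F) (hH : H ≤ stab C) {w h : G}
    (hh : h ∈ H) (hw : h + w ∉ F) : Disjoint C (coset H w) := by
  rw [Finset.disjoint_left]
  intro x hx hxw
  apply hw
  apply hC
  have h1 := H.sub_mem hh (mem_coset.1 hxw)
  have := (hH h1 x).2 hx
  convert this using 1
  abel

theorem kneser_piece {A B C : Finset G} {H : AddSubgroup G} {a b h : G} (hI : (A ∩ B).Nonempty)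
    (hCs : C ⊆ A + B)
    (hH : H ≤ stab C) (hKH : stab (A + B) ≤ H) (hKA : stab (A + B) ≤ stab A)
    (hconv : #(A ∩ B) + #(cl H (A ∪ B)) ≤ #C + Nat.card H)
    (ih : ∀ A' B' : Finset G, A'.Nonempty → B'.Nonempty → #(A' + B') < #(A + B) → KneserIneq A' B')
    (ihH : ∀ (C' : Finset G) (H' : AddSubgroup G), Nat.card H' < Nat.card H → C' ⊆ A + B →
      H' ≤ stab C' → stab (A + B) ≤ H' →
      #(A ∩ B) + #(cl H' (A ∪ B)) ≤ #C' + Nat.card H' → False)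
    (hh : h ∈ H) (hab : h + (a + b) ∉ A + B)
    (hA1 : (A ∩ coset H a).Nonempty) (hB1 : (B ∩ coset H b).Nonempty) :
    ∃ L ≤ H, #C + #(A ∩ coset H a + B ∩ coset H b) ≤ #(A + B) ∧
      #(cl L (A ∩ coset H a)) + #(cl L (B ∩ coset H b)) ≤
        #(A ∩ coset H a + B ∩ coset H b) + Nat.card L ∧
      #(cl H (A ∪ B)) + #(cl L (A ∩ coset H a)) + #(cl L (B ∩ coset H b)) <
        Nat.card H + #(cl L (A ∪ B)) := by
  set W := A ∩ coset H a + B ∩ coset H b with hW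
  have hWs : W ⊆ A + B := add_subset_add inter_subset_left inter_subset_left
  have hWc : W ⊆ coset H (a + b) := add_subset_coset inter_subset_right inter_subset_right
  have hWne : W.Nonempty := hA1.add hB1
  have hdisj : Disjoint C W := (disjoint_coset hCs hH hh hab).mono_right hWc
  have hLH : stab W ≤ H := stab_le_of_subset_coset hWne hWc
  have hlt : Nat.card (stab W) < Nat.card H := by
    refine lt_of_le_of_ne (Nat.card_mono (Set.toFinite _) hLH) fun he => hab ?_
    have hHL : H ≤ stab W := by
      have := AddSubgroup.eq_of_le_of_card_ge hLH he.ge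
      exact this.ge
    obtain ⟨x, hx⟩ := hWne
    apply hWs
    have h1 := H.sub_mem hh (mem_coset.1 (hWc hx))
    have := (hHL h1 x).2 hx
    convert this using 1
    abel
  have hcu : #(C ∪ W) = #C + #W := card_union_of_disjoint hdisj
  have hle : #C + #W ≤ #(A + B) := by
    rw [← hcu]
    exact card_le_card (union_subset hCs hWs)
  have hWlt : #W < #(A + B) := by
    refine card_lt_card ⟨hWs, fun hge => ?_⟩
    have hWe : W = A + B := hWs.antisymm hge
    have hCe : C = ∅ := by
      have : #C = 0 := by rw [hWe] at hle; omega
      simpa using this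
    obtain ⟨x, hx⟩ := hA1
    have hx' : x ∈ A ∪ B := mem_union_left _ (mem_inter.1 hx).1
    have h3 : coset H x ⊆ cl H (A ∪ B) := coset_subset (le_stab_cl _ _) (subset_cl _ _ hx')
    have h4 := card_le_card h3
    rw [card_coset] at h4
    simp only [hCe, card_empty] at hconv
    have h5 := hI.card_pos
    omega
  have hk := ih _ _ hA1 hB1 hWlt
  have hKW : stab (A + B) ≤ stab W :=
    le_stab_add_left (le_stab_inter hKA (hKH.trans (le_stab_coset H a)))
  refine ⟨stab W, hLH, hle, hk, ?_⟩
  by_contra hcon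
  push Not at hcon
  refine ihH (C ∪ W) (stab W) hlt (union_subset hCs hWs) (le_stab_union (hLH.trans hH) le_rfl) hKW ?_
  have hk' : #(cl (stab W) (A ∩ coset H a)) + #(cl (stab W) (B ∩ coset H b)) ≤
      #W + Nat.card (stab W) := hk
  rw [hcu]
  omega

theorem kneser_of_convergent {A B : Finset G} (hI : (A ∩ B).Nonempty)
    (hKA : stab (A + B) ≤ stab A)
    (ih : ∀ A' B' : Finset G, A'.Nonempty → B'.Nonempty → #(A' + B') < #(A + B) → KneserIneq A' B')
    {C : Finset G} {H : AddSubgroup G} (hCs : C ⊆ A + B) (hH : H ≤ stab C)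
    (hKH : stab (A + B) ≤ H) (hconv : #(A ∩ B) + #(cl H (A ∪ B)) ≤ #C + Nat.card H) :
    #A + #B ≤ #(A + B) + Nat.card (stab (A + B)) := by
  induction hm : Nat.card H using Nat.strong_induction_on generalizing C H with
  | _ m ihm =>
  subst hm
  have hUI := card_union_add_card_inter A B
  by_cases hHK : H ≤ stab (A + B)
  · have hHe := hHK.antisymm hKH
    have h1 := card_le_card (subset_cl H (A ∪ B))
    have h2 := card_le_card hCs
    rw [← hHe]
    omega
  by_contra hfail
  have ihH : ∀ (C' : Finset G) (H' : AddSubgroup G), Nat.card H' < Nat.card H → C' ⊆ A + B →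
      H' ≤ stab C' → stab (A + B) ≤ H' →
      #(A ∩ B) + #(cl H' (A ∪ B)) ≤ #C' + Nat.card H' → False :=
    fun C' H' h1 h2 h3 h4 h5 => hfail (ihm _ h1 h2 h3 h4 h5 rfl)
  obtain ⟨a, ha, b, hb, h, hh, hab⟩ : ∃ a ∈ A, ∃ b ∈ B, ∃ h ∈ H, h + (a + b) ∉ A + B := by
    by_contra hcon
    push Not at hcon
    refine hHK (le_stab_iff.2 fun h hh x hx => ?_)
    obtain ⟨a, ha, b, hb, rfl⟩ := mem_add.1 hx
    exact hcon a ha b hb h hh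
  have haU : coset H a ⊆ cl H (A ∪ B) :=
    coset_subset (le_stab_cl _ _) (subset_cl _ _ (mem_union_left _ ha))
  have hbU : coset H b ⊆ cl H (A ∪ B) :=
    coset_subset (le_stab_cl _ _) (subset_cl _ _ (mem_union_right _ hb))
  have hA1 : (A ∩ coset H a).Nonempty := ⟨a, mem_inter.2 ⟨ha, self_mem_coset H a⟩⟩
  have hB1 : (B ∩ coset H b).Nonempty := ⟨b, mem_inter.2 ⟨hb, self_mem_coset H b⟩⟩
  obtain ⟨L₁, hL₁, hle₁, hk₁, hlt₁⟩ := kneser_piece hI hCs hH hKH hKA hconv ih ihH hh hab hA1 hB1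
  have slice : ∀ c : G, coset H c ⊆ cl H (A ∪ B) → Nat.card H + #(cl L₁ (A ∪ B)) ≤
      #(cl H (A ∪ B)) + (#(cl L₁ (A ∩ coset H c)) + #(cl L₁ (B ∩ coset H c))) := by
    intro c hc
    have h1 := card_gap_le hL₁ (A ∪ B) hc
    have h2 := card_le_card (coset_inter_cl_subset hL₁ (A ∪ B) c)
    rw [union_inter_distrib_right, cl_union L₁ (A ∩ _)] at h2
    have h3 := card_union_le (cl L₁ (A ∩ coset H c)) (cl L₁ (B ∩ coset H c))
    rw [card_coset] at h1
    omega
  have hcl0 : cl L₁ (∅ : Finset G) = ∅ := by ext; simp [mem_cl]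
  have hB2 : (B ∩ coset H a).Nonempty := by
    by_contra hne
    rw [not_nonempty_iff_eq_empty] at hne
    have := slice a haU
    rw [hne, hcl0, card_empty] at this
    omega
  have hA2 : (A ∩ coset H b).Nonempty := by
    by_contra hne
    rw [not_nonempty_iff_eq_empty] at hne
    have := slice b hbU
    rw [hne, hcl0, card_empty] at this
    omega
  have hdis : Disjoint (coset H a) (coset H b) := by
    rw [Finset.disjoint_left]
    intro x hxa hxb
    have hcc : coset H a = coset H b := by
      have hd := H.sub_mem (mem_coset.1 hxb) (mem_coset.1 hxa)
      ext y
      rw [mem_coset, mem_coset]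
      constructor <;> intro hy
      · convert H.add_mem hy hd using 1; abel
      · convert H.sub_mem hy hd using 1; abel
    have := slice a haU
    rw [← hcc] at hlt₁
    omega
  obtain ⟨L₂, hL₂, hle₂, hk₂, hlt₂⟩ := kneser_piece hI hCs hH hKH hKA hconv ih ihH hh
    (by rwa [add_comm b a]) hA2 hB2
  have bound : ∀ L ≤ H, ∀ X Y : Finset G,
      #(cl H (A ∪ B)) + #(cl L X) + #(cl L Y) < Nat.card H + #(cl L (A ∪ B)) →
      #(cl L X) + #(cl L Y) + Nat.card L ≤ Nat.card H := by
    intro L hL X Y hlt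
    have h1 := card_le_card (cl_mono_left hL (A := A ∪ B))
    obtain ⟨r, hr⟩ := card_dvd_of_le_stab (le_stab_cl L X)
    obtain ⟨s, hs⟩ := card_dvd_of_le_stab (le_stab_cl L Y)
    obtain ⟨t, ht⟩ := AddSubgroup.card_dvd_of_le hL
    have hlt' : Nat.card L * (r + s) < Nat.card L * t := by
      rw [mul_add, ← hr, ← hs, ← ht]
      omega
    have h2 : r + s + 1 ≤ t := lt_of_mul_lt_mul_left hlt' (Nat.zero_le _)
    have h3 := Nat.mul_le_mul_left (Nat.card L) h2
    rw [hr, hs, ht]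
    linarith
  have hb₁ := bound L₁ hL₁ _ _ hlt₁
  have hb₂ := bound L₂ hL₂ _ _ hlt₂
  have hgap := card_gap_le (bot_le : ⊥ ≤ H) (A ∪ B) (union_subset haU hbU)
  rw [cl_bot, card_union_of_disjoint hdis, card_coset, card_coset] at hgap
  have hcap : #((coset H a ∪ coset H b) ∩ (A ∪ B)) ≤
      #(A ∩ coset H a) + #(B ∩ coset H b) + #(A ∩ coset H b) + #(B ∩ coset H a) := by
    have hs : (coset H a ∪ coset H b) ∩ (A ∪ B) ⊆
        (A ∩ coset H a ∪ B ∩ coset H b) ∪ (A ∩ coset H b ∪ B ∩ coset H a) := by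
      intro x
      simp only [mem_inter, mem_union]
      tauto
    have h0 := card_le_card hs
    have h1 := card_union_le (A ∩ coset H a ∪ B ∩ coset H b) (A ∩ coset H b ∪ B ∩ coset H a)
    have h2 := card_union_le (A ∩ coset H a) (B ∩ coset H b)
    have h3 := card_union_le (A ∩ coset H b) (B ∩ coset H a)
    omega
  have e₁ := card_le_card (subset_cl L₁ (A ∩ coset H a))
  have e₂ := card_le_card (subset_cl L₁ (B ∩ coset H b))
  have e₃ := card_le_card (subset_cl L₂ (A ∩ coset H b))
  have e₄ := card_le_card (subset_cl L₂ (B ∩ coset H a))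
  omega

/-- **Kneser's theorem**, with the bound stated for the closures under the stabilizer. -/
theorem kneser (A B : Finset G) (hA : A.Nonempty) (hB : B.Nonempty) : KneserIneq A B := by
  induction hN : #(A + B) using Nat.strong_induction_on generalizing A B with
  | _ N ihN =>
  have inner : ∀ m, ∀ A B : Finset G, A.Nonempty → B.Nonempty → #(A + B) = N → #A = m →
      stab (A + B) ≤ stab A → stab (A + B) ≤ stab B →
      #A + #B ≤ #(A + B) + Nat.card (stab (A + B)) := by
    intro m
    induction m using Nat.strong_induction_on with
    | _ m ihm =>
    intro A B hA hB hN hm hKA hKB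
    obtain ⟨a₀, ha₀⟩ := hA
    by_cases hsingle : ∀ x ∈ A, x - a₀ ∈ stab (A + B)
    · have h1 := card_le_of_forall_sub_mem hsingle
      have h2 := card_le_card_add_left (s := A) (t := B) ⟨a₀, ha₀⟩
      omega
    push Not at hsingle
    obtain ⟨a₁, ha₁, hd⟩ := hsingle
    obtain ⟨b, hb, hb'⟩ : ∃ b ∈ B, (a₁ - a₀) + b ∉ B := by
      by_contra hcon
      push Not at hcon
      exact hd (le_stab_add_right le_rfl (mem_stab_of_forall hcon))
    set B' : Finset G := {a₀ - b} + B with hB'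
    have hcB : #B' = #B := card_singleton_add _ _
    have hsum : A + B' = {a₀ - b} + (A + B) := by rw [hB', add_left_comm]
    have hcS : #(A + B') = #(A + B) := by rw [hsum, card_singleton_add]
    have hst : stab (A + B') = stab (A + B) := by rw [hsum, stab_singleton_add]
    have hKB' : stab (A + B') ≤ stab B' := by rwa [hst, hB', stab_singleton_add]
    have hKA' : stab (A + B') ≤ stab A := by rwa [hst]
    have ha₀B : a₀ ∈ B' := mem_add.2 ⟨_, mem_singleton_self _, b, hb, by abel⟩
    have ha₁B : a₁ ∉ B' := by
      intro hmem
      obtain ⟨t, ht, y, hy, hty⟩ := mem_add.1 hmem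
      rw [mem_singleton] at ht
      subst ht
      apply hb'
      rw [← hty]
      convert hy using 1
      abel
    have hI : (A ∩ B').Nonempty := ⟨a₀, mem_inter.2 ⟨ha₀, ha₀B⟩⟩
    have hIlt : #(A ∩ B') < m := by
      rw [← hm]
      exact card_lt_card ⟨inter_subset_left, fun h => ha₁B (mem_inter.1 (h ha₁)).2⟩
    have hUne : (A ∪ B').Nonempty := ⟨a₀, mem_union_left _ ha₀⟩
    rw [← hcB, ← hcS, ← hst]
    have hC : A ∩ B' + (A ∪ B') ⊆ A + B' := inter_add_union_subset
    have hKI : stab (A + B') ≤ stab (A ∩ B') := le_stab_inter hKA' hKB'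
    have hKU : stab (A + B') ≤ stab (A ∪ B') := le_stab_union hKA' hKB'
    refine kneser_of_convergent hI hKA' (fun A' B'' h1 h2 h3 => ihN _ (by omega) A' B'' h1 h2 rfl)
      hC le_rfl (le_stab_add_left hKI) ?_
    rcases (card_le_card hC).lt_or_eq with hlt | heq
    · have := ihN _ (by omega) _ _ hI hUne rfl
      have h2 := card_le_card (subset_cl (stab (A ∩ B' + (A ∪ B'))) (A ∩ B'))
      unfold KneserIneq at this
      omega
    · have hCe := eq_of_subset_of_card_le hC heq.ge
      have := ihm _ hIlt (A ∩ B') (A ∪ B') hI hUne (by omega) rfl (by rwa [hCe]) (by rwa [hCe])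
      rwa [cl_eq_of_le_stab (by rwa [hCe])]
  set K := stab (A + B) with hK
  have hsum : cl K A + cl K B = A + B := by
    rw [← cl_add, add_comm (cl K A), ← cl_add, cl_cl le_rfl, add_comm B A, cl_eq_of_le_stab le_rfl]
  have := inner _ (cl K A) (cl K B) (hA.mono (subset_cl _ _)) (hB.mono (subset_cl _ _))
    (by rw [hsum, hN]) rfl (by rw [hsum]; exact le_stab_cl _ _) (by rw [hsum]; exact le_stab_cl _ _)
  rwa [hsum] at this

end Kneser

section DeVosGoddynMohar

theorem exists_le_card_eq {α : Type*} {S : Multiset α} {n : ℕ} (h : n ≤ Multiset.card S) :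
    ∃ T ≤ S, Multiset.card T = n := by
  induction S using Quotient.inductionOn with
  | _ l => exact ⟨l.take n, (List.take_sublist n l).subperm, by simpa using h⟩

variable {G : Type u} [AddCommGroup G]

/-- The number of terms of `S` in the coset `x + H`. -/
noncomputable def mult (S : Multiset G) (H : AddSubgroup G) (x : G) : ℕ :=
  Multiset.card (S.filter fun y => y - x ∈ H)

theorem mult_le_card (S : Multiset G) (H : AddSubgroup G) (x : G) :
    mult S H x ≤ Multiset.card S := Multiset.card_le_card (Multiset.filter_le _ _)

theorem mult_mono {S T : Multiset G} (h : T ≤ S) (H : AddSubgroup G) (x : G) :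
    mult T H x ≤ mult S H x := Multiset.card_le_card (Multiset.filter_le_filter _ h)

theorem mult_mono_left {H K : AddSubgroup G} (h : K ≤ H) (S : Multiset G) (x : G) :
    mult S K x ≤ mult S H x :=
  Multiset.card_le_card (Multiset.monotone_filter_right S fun _ hb => h hb)

theorem mult_add (S T : Multiset G) (H : AddSubgroup G) (x : G) :
    mult (S + T) H x = mult S H x + mult T H x := by simp [mult]

theorem mult_congr {H : AddSubgroup G} {x y : G} (h : x - y ∈ H) (S : Multiset G) :
    mult S H x = mult S H y := by
  unfold mult
  congr 1
  refine Multiset.filter_congr fun z _ => ?_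
  constructor <;> intro hz
  · simpa using H.add_mem hz h
  · simpa using H.sub_mem hz h

/-- The terms of `S` in the coset `q` of `H`. -/
noncomputable def slice (S : Multiset G) {H : AddSubgroup G} (q : G ⧸ H) : Multiset G :=
  S.filter fun y : G => (y : G ⧸ H) = q

theorem slice_le (S : Multiset G) {H : AddSubgroup G} (q : G ⧸ H) : slice S q ≤ S :=
  Multiset.filter_le _ _

theorem card_slice (S : Multiset G) (H : AddSubgroup G) (x : G) :
    Multiset.card (slice S (x : G ⧸ H)) = mult S H x := by
  unfold slice mult
  congr 1
  refine Multiset.filter_congr fun z _ => ?_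
  rw [eq_comm, QuotientAddGroup.eq, neg_add_eq_sub]

theorem mult_slice {H L : AddSubgroup G} (hL : L ≤ H) (S : Multiset G) (x : G) :
    mult (slice S (x : G ⧸ H)) L x = mult S L x := by
  unfold slice mult
  rw [Multiset.filter_filter]
  congr 1
  refine Multiset.filter_congr fun z _ => ?_
  rw [eq_comm, QuotientAddGroup.eq, neg_add_eq_sub, and_iff_left_iff_imp]
  exact fun h => hL h

theorem count_map_mk (T : Multiset G) {H : AddSubgroup G} (q : G ⧸ H) :
    (T.map fun y : G => (y : G ⧸ H)).count q = Multiset.card (slice T q) := by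
  rw [Multiset.count_map, slice]
  congr 1
  exact Multiset.filter_congr fun z _ => eq_comm

theorem mk_sum_eq_nsmul {T : Multiset G} {H : AddSubgroup G} {q : G ⧸ H}
    (h : ∀ y ∈ T, (y : G ⧸ H) = q) : (T.sum : G ⧸ H) = Multiset.card T • q := by
  have h1 : (T.sum : G ⧸ H) = (T.map fun y : G => (y : G ⧸ H)).sum :=
    map_multiset_sum (QuotientAddGroup.mk' H) T
  have h2 : (T.map fun y : G => (y : G ⧸ H)) = Multiset.replicate (Multiset.card T) q := by
    rw [Multiset.map_congr rfl h, Multiset.map_const']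
  rw [h1, h2, Multiset.sum_replicate]

theorem sum_nonempty {ι : Type*} {s : Finset ι} {F : ι → Finset G}
    (hF : ∀ i ∈ s, (F i).Nonempty) : (∑ i ∈ s, F i).Nonempty := by
  induction s using Finset.induction_on with
  | empty => simp
  | insert a s ha ih =>
    rw [sum_insert ha]
    exact (hF a (mem_insert_self _ _)).add (ih fun i hi => hF i (mem_insert_of_mem hi))

variable [Fintype G]

/-- The sums of the `n`-term subsequences of `S`, as a finite set. -/
noncomputable def sums (S : Multiset G) (n : ℕ) : Finset G :=
  univ.filter fun x => ∃ T ≤ S, Multiset.card T = n ∧ T.sum = x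

theorem mem_sums {S : Multiset G} {n : ℕ} {x : G} :
    x ∈ sums S n ↔ ∃ T ≤ S, Multiset.card T = n ∧ T.sum = x := by simp [sums]

theorem sum_mem_sums {S T : Multiset G} (h : T ≤ S) : T.sum ∈ sums S (Multiset.card T) :=
  mem_sums.2 ⟨T, h, rfl, rfl⟩

theorem sums_nonempty {S : Multiset G} {n : ℕ} (h : n ≤ Multiset.card S) : (sums S n).Nonempty := by
  obtain ⟨T, hT, rfl⟩ := exists_le_card_eq h
  exact ⟨_, sum_mem_sums hT⟩

theorem mult_val (A : Finset G) (H : AddSubgroup G) (x : G) :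
    mult A.val H x = #(A ∩ coset H x) := by
  have : A ∩ coset H x = A.filter fun y => y - x ∈ H := by
    ext y
    simp [mem_coset]
  rw [this]
  rfl

theorem sum_mult (S : Multiset G) (H : AddSubgroup G) :
    ∑ x, mult S H x = Nat.card H * Multiset.card S := by
  induction S using Multiset.induction_on with
  | empty => simp [mult]
  | cons a S ih =>
    rw [← Multiset.singleton_add]
    simp only [mult_add, sum_add_distrib, ih, Multiset.card_add, Multiset.card_singleton, mul_add,
      mul_one, add_left_inj]
    have : ∀ x, mult {a} H x = if x ∈ coset H a then 1 else 0 := by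
      intro x
      have hiff : a - x ∈ H ↔ x - a ∈ H := by rw [← H.neg_mem_iff, neg_sub]
      simp only [mult, mem_coset, Multiset.filter_singleton, hiff]
      split_ifs <;> rfl
    simp only [this, sum_boole, filter_mem_eq_inter, univ_inter, card_coset, Nat.cast_id]

theorem exists_transversal {S : Multiset G} {n : ℕ} (K : AddSubgroup G) (hn : 1 ≤ n)
    (hS : n ≤ Multiset.card S) :
    ∃ A : Finset G, A.Nonempty ∧ A.val ≤ S ∧ n - 1 ≤ Multiset.card (S - A.val) ∧
      (∀ x, #(A ∩ coset K x) ≤ 1) ∧ (∀ x, n ≤ mult S K x → (A ∩ coset K x).Nonempty) ∧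
      ∀ H, K ≤ H → ∀ x, mult (S - A.val) H x < n - 1 → #(A ∩ coset H x) ≤ 1 := by
  by_cases hex : ∃ x, n ≤ mult S K x
  · obtain ⟨x₀, hx₀⟩ := hex
    have hrep : ∀ q : G ⧸ K, ∃ y : G, n ≤ mult S K q.out → y ∈ S ∧ y - q.out ∈ K := by
      intro q
      by_cases hq : n ≤ mult S K q.out
      · have hpos : 0 < mult S K q.out := by omega
        obtain ⟨y, hy⟩ := Multiset.card_pos_iff_exists_mem.1 hpos
        exact ⟨y, fun _ => Multiset.mem_filter.1 hy⟩
      · exact ⟨0, fun h => absurd h hq⟩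
    choose f hf using hrep
    have hout : ∀ x : G, (x : G ⧸ K).out - x ∈ K := by
      intro x
      have h1 : ((x : G ⧸ K).out : G ⧸ K) = x := Quotient.out_eq' _
      have := QuotientAddGroup.eq.1 h1.symm
      rwa [neg_add_eq_sub] at this
    set A : Finset G := (univ.filter fun q : G ⧸ K => n ≤ mult S K q.out).image f with hA
    have hmemA : ∀ a ∈ A, n ≤ mult S K a ∧ a ∈ S ∧ f (a : G ⧸ K) = a := by
      intro a ha
      obtain ⟨q, hq, rfl⟩ := mem_image.1 ha
      have hq' : n ≤ mult S K q.out := by simpa using hq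
      obtain ⟨h1, h2⟩ := hf q hq'
      refine ⟨by rwa [mult_congr h2], h1, ?_⟩
      congr 1
      rw [← Quotient.out_eq' q]
      refine (QuotientAddGroup.eq.2 ?_).symm
      rw [neg_add_eq_sub]
      simpa using h2
    have hAS : A.val ≤ S := (Multiset.le_iff_subset A.nodup).2 fun a ha => (hmemA a ha).2.1
    have hne : ∀ x, n ≤ mult S K x → (A ∩ coset K x).Nonempty := by
      intro x hx
      have h1 : n ≤ mult S K (x : G ⧸ K).out := by rwa [mult_congr (hout x)]
      refine ⟨f x, mem_inter.2 ⟨mem_image.2 ⟨x, by simpa using h1, rfl⟩, mem_coset.2 ?_⟩⟩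
      have := K.add_mem (hf _ h1).2 (hout x)
      simpa using this
    have hone : ∀ x, #(A ∩ coset K x) ≤ 1 := by
      intro x
      refine card_le_one.2 fun a ha b hb => ?_
      rw [mem_inter, mem_coset] at ha hb
      rw [← (hmemA a ha.1).2.2, ← (hmemA b hb.1).2.2]
      congr 1
      refine QuotientAddGroup.eq.2 ?_
      rw [neg_add_eq_sub]
      simpa using K.sub_mem hb.2 ha.2
    have hv : ∀ H : AddSubgroup G, ∀ x, mult S H x = mult (S - A.val) H x + #(A ∩ coset H x) := by
      intro H x
      rw [← mult_val, ← mult_add, Multiset.sub_add_cancel hAS]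
    have hvA : ∀ a ∈ A, n - 1 ≤ mult (S - A.val) K a := by
      intro a ha
      have h1 := (hmemA a ha).1
      have h2 := hv K a
      have h3 := hone a
      omega
    obtain ⟨a, ha⟩ := hne x₀ hx₀
    have haA := (mem_inter.1 ha).1
    refine ⟨A, ⟨a, haA⟩, hAS, (hvA a haA).trans (mult_le_card _ _ _), hone, hne, ?_⟩
    intro H hKH x hx
    by_contra hcon
    obtain ⟨b, hb⟩ : (A ∩ coset H x).Nonempty := card_pos.1 (by omega)
    rw [mem_inter, mem_coset] at hb
    have h1 := hvA b hb.1
    have h2 := mult_mono_left hKH (S - A.val) b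
    rw [mult_congr hb.2] at h2
    omega
  · obtain ⟨y, hy⟩ := Multiset.card_pos_iff_exists_mem.1 (hn.trans hS)
    have hle : ∀ B : Finset G, #({y} ∩ B) ≤ 1 := fun B =>
      (card_le_card inter_subset_left).trans (card_singleton y).le
    refine ⟨{y}, singleton_nonempty y, by simpa using hy, ?_, fun x => hle _,
      fun x hx => absurd ⟨x, hx⟩ hex, fun H _ x _ => hle _⟩
    rw [Multiset.card_sub (by simpa using hy)]
    simp only [singleton_val, Multiset.card_singleton]
    omega

theorem kneser_sum {ι : Type*} (s : Finset ι) (F : ι → Finset G) (hF : ∀ i ∈ s, (F i).Nonempty)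
    (L : AddSubgroup G) (hL : stab (cl L (∑ i ∈ s, F i)) ≤ L) :
    ∑ i ∈ s, #(cl L (F i)) + Nat.card L ≤ #(cl L (∑ i ∈ s, F i)) + #s * Nat.card L := by
  induction s using Finset.induction_on with
  | empty =>
    have := card_le_card (coset_subset (le_stab_cl L 0) (subset_cl L (0 : Finset G) (zero_mem_zero)))
    rw [card_coset] at this
    simpa using this
  | insert a s ha ih =>
    rw [sum_insert ha] at hL ⊢
    rw [sum_insert ha, card_insert_of_notMem ha]
    set Y := ∑ i ∈ s, F i with hY
    have hadd : cl L (F a + Y) = cl L (F a) + cl L Y := by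
      rw [← cl_add, add_comm (cl L (F a)), ← cl_add, cl_cl le_rfl, add_comm]
    have hYne : Y.Nonempty := sum_nonempty fun i hi => hF i (mem_insert_of_mem hi)
    have h1 := ih (fun i hi => hF i (mem_insert_of_mem hi))
      ((le_stab_add_right le_rfl).trans (hadd ▸ hL))
    have h2 := kneser (cl L (F a)) (cl L Y) ((hF a (mem_insert_self _ _)).mono (subset_cl _ _))
      (hYne.mono (subset_cl _ _))
    have hst : stab (cl L (F a + Y)) = L := hL.antisymm (le_stab_cl _ _)
    unfold KneserIneq at h2
    rw [← hadd, hst, cl_cl le_rfl, cl_cl le_rfl] at h2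
    rw [add_mul]
    omega

/-- Sums of subsequences of `S` with the same number of terms as `T` in each coset of `H`. -/
noncomputable def sliceSums (S T : Multiset G) (H : AddSubgroup G) : Finset G :=
  ∑ q : G ⧸ H, sums (slice S q) (Multiset.card (slice T q))

theorem exists_of_mem_sum_slice {S : Multiset G} {H : AddSubgroup G} (s : Finset (G ⧸ H))
    (c : G ⧸ H → ℕ) {x : G} (hx : x ∈ ∑ q ∈ s, sums (slice S q) (c q)) :
    (x : G ⧸ H) = ∑ q ∈ s, c q • q ∧
      ∃ T : Multiset G, T ≤ S.filter (fun y : G => (y : G ⧸ H) ∈ s) ∧ Multiset.card T = ∑ q ∈ s, c q ∧ T.sum = x := by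
  induction s using Finset.induction_on generalizing x with
  | empty =>
    rw [sum_empty, mem_zero] at hx
    subst hx
    exact ⟨by simp, 0, by simp, by simp, by simp⟩
  | insert a s ha ih =>
    rw [sum_insert ha] at hx
    obtain ⟨y, hy, z, hz, rfl⟩ := mem_add.1 hx
    obtain ⟨hz1, T, hT, hTc, rfl⟩ := ih hz
    obtain ⟨T', hT', hTc', rfl⟩ := mem_sums.1 hy
    rw [sum_insert ha, sum_insert ha]
    refine ⟨?_, T' + T, ?_, by rw [Multiset.card_add, hTc, hTc'], by rw [Multiset.sum_add]⟩
    · rw [QuotientAddGroup.mk_add, hz1, ← hTc']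
      congr 1
      exact mk_sum_eq_nsmul fun y hy => (Multiset.mem_filter.1 (Multiset.mem_of_le hT' hy)).2
    · have hd : S.filter (fun y : G => (y : G ⧸ H) ∈ insert a s) =
          slice S a + S.filter (fun y : G => (y : G ⧸ H) ∈ s) := by
        unfold slice
        have h0 : S.filter (fun y : G => (y : G ⧸ H) = a ∧ (y : G ⧸ H) ∈ s) = 0 :=
          Multiset.filter_eq_nil.2 fun y _ hy => ha (hy.1 ▸ hy.2)
        rw [Multiset.filter_add_filter, h0, add_zero]
        exact Multiset.filter_congr fun y _ => mem_insert
      rw [hd]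
      exact add_le_add hT' hT

theorem sum_mk (T : Multiset G) (H : AddSubgroup G) :
    (T.sum : G ⧸ H) = ∑ q : G ⧸ H, Multiset.card (slice T q) • q := by
  have h1 : (T.sum : G ⧸ H) = (T.map fun y : G => (y : G ⧸ H)).sum :=
    map_multiset_sum (QuotientAddGroup.mk' H) T
  rw [h1, Finset.sum_multiset_count_of_subset _ univ (subset_univ _)]
  simp only [count_map_mk]

theorem sum_card_slice (T : Multiset G) (H : AddSubgroup G) :
    ∑ q : G ⧸ H, Multiset.card (slice T q) = Multiset.card T := by
  simp only [← count_map_mk]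
  rw [Multiset.sum_count_eq_card fun a _ => mem_univ a, Multiset.card_map]

theorem sliceSums_subset_coset (S T : Multiset G) (H : AddSubgroup G) :
    sliceSums S T H ⊆ coset H T.sum := by
  intro x hx
  have h1 := (exists_of_mem_sum_slice _ _ hx).1
  rw [← sum_mk, eq_comm, QuotientAddGroup.eq, neg_add_eq_sub] at h1
  exact mem_coset.2 h1

theorem sliceSums_subset_sums (S T : Multiset G) (H : AddSubgroup G) :
    sliceSums S T H ⊆ sums S (Multiset.card T) := by
  intro x hx
  obtain ⟨-, T', hT', hc, rfl⟩ := exists_of_mem_sum_slice _ _ hx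
  rw [sum_card_slice] at hc
  exact mem_sums.2 ⟨T', hT'.trans (Multiset.filter_le _ _), hc, rfl⟩

theorem sliceSums_nonempty {S T : Multiset G} (hT : T ≤ S) (H : AddSubgroup G) :
    (sliceSums S T H).Nonempty :=
  sum_nonempty fun _ _ => sums_nonempty (Multiset.card_le_card (Multiset.filter_le_filter _ hT))

/-- The inequality of the DeVos–Goddyn–Mohar theorem. -/
def DGMIneq (S : Multiset G) (n : ℕ) (K : AddSubgroup G) : Prop :=
  Nat.card K + ∑ x, min n (mult S K x) ≤ #(cl K (sums S n)) + n * Nat.card K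

theorem sliceSums_ineq {S T : Multiset G} (hT : T ≤ S) {H L : AddSubgroup G} (hLH : L ≤ H)
    (hL : stab (cl L (sliceSums S T H)) ≤ L)
    (ih : ∀ q : G ⧸ H, stab (cl L (sums (slice S q) (Multiset.card (slice T q)))) ≤ L →
      DGMIneq (slice S q) (Multiset.card (slice T q)) L) :
    Nat.card L + ∑ x, min (mult T H x) (mult S L x) ≤
      #(cl L (sliceSums S T H)) + Multiset.card T * Nat.card L := by
  have hne : ∀ q : G ⧸ H, (sums (slice S q) (Multiset.card (slice T q))).Nonempty := fun q =>
    sums_nonempty (Multiset.card_le_card (Multiset.filter_le_filter _ hT))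
  have h1 := kneser_sum (univ : Finset (G ⧸ H)) _ (fun q _ => hne q) L hL
  have h2 : ∀ q : G ⧸ H, DGMIneq (slice S q) (Multiset.card (slice T q)) L := by
    intro q
    refine ih q (le_trans ?_ hL)
    unfold sliceSums
    rw [← add_sum_erase univ _ (mem_univ q), add_comm, cl_add]
    exact le_stab_add_right le_rfl
  have h3 := sum_le_sum fun q (_ : q ∈ (univ : Finset (G ⧸ H))) => h2 q
  simp only [sum_add_distrib, ← sum_mul, sum_card_slice, sum_const, smul_eq_mul] at h3
  have h4 : ∑ x, min (mult T H x) (mult S L x) ≤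
      ∑ q : G ⧸ H, ∑ x, min (Multiset.card (slice T q)) (mult (slice S q) L x) := by
    rw [sum_comm]
    refine sum_le_sum fun x _ => ?_
    have := single_le_sum (f := fun q : G ⧸ H =>
      min (Multiset.card (slice T q)) (mult (slice S q) L x)) (fun _ _ => Nat.zero_le _)
      (mem_univ (x : G ⧸ H))
    rwa [card_slice, mult_slice hLH] at this
  unfold sliceSums at *
  omega

theorem dgm_of_convergent {S : Multiset G} {n : ℕ} {K : AddSubgroup G} (hn : 1 ≤ n)
    (hK : stab (cl K (sums S n)) ≤ K)
    (ih : ∀ (S' : Multiset G) (n' : ℕ) (L : AddSubgroup G), Multiset.card S' < Multiset.card S →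
      n' ≤ Multiset.card S' → stab (cl L (sums S' n')) ≤ L → DGMIneq S' n' L)
    {A : Finset G} (hAS : A.val ≤ S) (hone : ∀ x, #(A ∩ coset K x) ≤ 1)
    (hbig : ∀ x, n ≤ mult S K x → (A ∩ coset K x).Nonempty)
    (hsmall : ∀ H, K ≤ H → ∀ x, mult (S - A.val) H x < n - 1 → #(A ∩ coset H x) ≤ 1)
    {C : Finset G} {H : AddSubgroup G} (hCne : C.Nonempty) (hC : C ⊆ cl K (sums S n))
    (hH : H ≤ stab C) (hKH : K ≤ H)
    (hconv : Nat.card H + ∑ x, (min 1 #(A ∩ coset H x) + min (n - 1) (mult (S - A.val) H x)) ≤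
      #C + n * Nat.card H) :
    DGMIneq S n K := by
  induction hm : Nat.card H using Nat.strong_induction_on generalizing C H with
  | _ m ihm =>
  subst hm
  have hv : ∀ (H : AddSubgroup G) (x : G), mult S H x = mult (S - A.val) H x + #(A ∩ coset H x) := by
    intro H x
    rw [← mult_val, ← mult_add, Multiset.sub_add_cancel hAS]
  set F := cl K (sums S n) with hF
  by_cases hHF : H ≤ stab F
  · obtain rfl : H = K := (hHF.trans hK).antisymm hKH
    have h1 : ∑ x, min n (mult S H x) ≤
        ∑ x, (min 1 #(A ∩ coset H x) + min (n - 1) (mult (S - A.val) H x)) := by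
      refine sum_le_sum fun x _ => ?_
      have h1 := hone x
      have h2 := hv H x
      by_cases hx : n ≤ mult S H x
      · have := (hbig x hx).card_pos
        omega
      · omega
    have h2 := card_le_card hC
    unfold DGMIneq
    rw [← hF]
    omega
  obtain ⟨T, hT, hTn, h, hh, hhT⟩ : ∃ T ≤ S, Multiset.card T = n ∧ ∃ h ∈ H, h + T.sum ∉ F := by
    by_contra hcon
    push Not at hcon
    refine hHF (le_stab_iff.2 fun h hh x hx => ?_)
    obtain ⟨y, hy, hxy⟩ := mem_cl.1 hx
    obtain ⟨T, hT, hTn, rfl⟩ := mem_sums.1 hy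
    have := (le_stab_cl K (sums S n) hxy _).2 (hcon T hT hTn h hh)
    convert this using 1
    abel
  set W := sliceSums S T H with hW
  have hWc : cl K W ⊆ coset H T.sum :=
    cl_subset_of_le_stab (sliceSums_subset_coset S T H) (hKH.trans (le_stab_coset H _))
  have hWF : cl K W ⊆ F := by
    have := sliceSums_subset_sums S T H
    rw [hTn] at this
    exact cl_mono this
  have hWne : (cl K W).Nonempty := (sliceSums_nonempty hT H).mono (subset_cl _ _)
  have hdisj : Disjoint C (cl K W) := (disjoint_coset hC hH hh hhT).mono_right hWc
  have no_period : ∀ D : Finset G, D.Nonempty → D ⊆ coset H T.sum → D ⊆ F → ¬ H ≤ stab D := by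
    rintro D ⟨x, hx⟩ hDc hDF hHD
    apply hhT
    apply hDF
    have := (hHD (H.sub_mem hh (mem_coset.1 (hDc hx))) x).2 hx
    convert this using 1
    abel
  set L := stab (cl K W) with hL
  have hKL : K ≤ L := le_stab_cl K W
  have hLH : L ≤ H := stab_le_of_subset_coset hWne hWc
  have hclL : cl L W = cl K W := by rw [← cl_cl hKL, cl_eq_of_le_stab le_rfl]
  have hlt : Nat.card L < Nat.card H := by
    refine lt_of_le_of_ne (Nat.card_mono (Set.toFinite _) hLH) fun he => ?_
    exact no_period _ hWne hWc hWF (AddSubgroup.eq_of_le_of_card_ge hLH he.ge).ge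
  have hslt : ∀ q : G ⧸ H, Multiset.card (slice S q) < Multiset.card S := by
    intro q
    refine lt_of_le_of_ne (Multiset.card_le_card (slice_le S q)) fun he => ?_
    have hSq : slice S q = S := Multiset.eq_of_le_of_card_le (slice_le S q) he.ge
    have hmk : ∀ T' ≤ S, Multiset.card T' = n → (T'.sum : G ⧸ H) = n • q := by
      intro T' hT' hc
      rw [mk_sum_eq_nsmul (q := q), hc]
      intro z hz
      have := Multiset.mem_of_le hT' hz
      rw [← hSq] at this
      exact (Multiset.mem_filter.1 this).2
    refine no_period C hCne (fun x hx => ?_) hC hH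
    obtain ⟨y, hy, hxy⟩ := mem_cl.1 (hC hx)
    obtain ⟨T', hT', hc, rfl⟩ := mem_sums.1 hy
    have h2 := (hmk T hT hTn).trans (hmk T' hT' hc).symm
    rw [QuotientAddGroup.eq, neg_add_eq_sub] at h2
    rw [mem_coset]
    have := H.add_mem (hKH hxy) h2
    simpa using this
  have hineq := sliceSums_ineq hT hLH (by rw [hclL]) fun q =>
    ih _ _ L (hslt q) (Multiset.card_le_card (Multiset.filter_le_filter _ hT))
  refine ihm _ hlt (C := C ∪ cl K W) (H := L) (hCne.mono subset_union_left) (union_subset hC hWF)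
    (le_stab_union (hLH.trans hH) le_rfl) hKL ?_ rfl
  rw [card_union_of_disjoint hdisj]
  have hpt : ∀ x, min 1 #(A ∩ coset L x) + min (n - 1) (mult (S - A.val) L x) + mult T H x ≤
      min 1 #(A ∩ coset H x) + min (n - 1) (mult (S - A.val) H x) +
        min (mult T H x) (mult S L x) + (if mult T H x = n then 1 else 0) := by
    intro x
    have h1 := mult_le_card T H x
    have h2 := mult_mono hT H x
    have h3 := hsmall H hKH x
    have h4 := hv H x
    have h5 := hv L x
    have h6 := mult_mono_left hLH (S - A.val) x
    have h7 : #(A ∩ coset L x) ≤ #(A ∩ coset H x) := by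
      rw [← mult_val, ← mult_val]
      exact mult_mono_left hLH _ x
    rw [hTn] at h1
    split_ifs <;> omega
  have hsum := sum_le_sum fun x (_ : x ∈ (univ : Finset G)) => hpt x
  have hfull : ∑ x, (if mult T H x = n then 1 else 0) ≤ Nat.card H := by
    rw [sum_boole, Nat.cast_id]
    obtain ⟨t, ht⟩ := Multiset.card_pos_iff_exists_mem.1 (by omega : 0 < Multiset.card T)
    rw [← card_coset H t]
    refine card_le_card fun x hx => ?_
    have hx1 : mult T H x = n := by simpa using hx
    have hx2 : T.filter (fun y => y - x ∈ H) = T :=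
      Multiset.eq_of_le_of_card_le (Multiset.filter_le _ _) (by rw [hTn]; exact hx1.ge)
    rw [← hx2] at ht
    have := H.neg_mem (Multiset.mem_filter.1 ht).2
    rwa [neg_sub, ← mem_coset] at this
  have hTm := sum_mult T H
  rw [hTn, mul_comm] at hTm
  rw [hTn, hclL] at hineq
  simp only [sum_add_distrib] at hsum hconv ⊢
  omega

/-- The **DeVos–Goddyn–Mohar theorem** for the sums of `n`-term subsequences. -/
theorem dgm (S : Multiset G) (n : ℕ) (K : AddSubgroup G) (hS : n ≤ Multiset.card S)
    (hK : stab (cl K (sums S n)) ≤ K) : DGMIneq S n K := by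
  induction hc : Multiset.card S using Nat.strong_induction_on generalizing S n K with
  | _ c ihc =>
  subst hc
  rcases Nat.eq_zero_or_pos n with rfl | hn
  · obtain ⟨x, hx⟩ := (sums_nonempty hS).mono (subset_cl K _)
    have := card_le_card (coset_subset (le_stab_cl K _) hx)
    rw [card_coset] at this
    simpa [DGMIneq] using this
  obtain ⟨A, hAne, hAS, hc', hone, hbig, hsmall⟩ := exists_transversal K hn hS
  have hlt : Multiset.card (S - A.val) < Multiset.card S := by
    have h1 := Multiset.card_sub hAS
    have h2 := hAne.card_pos
    have h3 := Multiset.card_le_card hAS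
    rw [card_val] at h1 h3
    omega
  set B := sums (S - A.val) (n - 1) with hB
  have hBne : B.Nonempty := sums_nonempty hc'
  have hAB : A + B ⊆ sums S n := by
    intro x hx
    obtain ⟨a, ha, b, hb, rfl⟩ := mem_add.1 hx
    obtain ⟨T, hT, hTc, rfl⟩ := mem_sums.1 hb
    refine mem_sums.2 ⟨{a} + T, ?_, ?_, by simp⟩
    · rw [← add_tsub_cancel_of_le hAS]
      exact add_le_add (Multiset.singleton_le.2 ha) hT
    · rw [Multiset.card_add, Multiset.card_singleton, hTc]
      omega
  set C := cl K (A + B) with hC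
  set H := stab C with hH
  have hKH : K ≤ H := le_stab_cl _ _
  have hCH : C = A + cl H B := by
    rw [← cl_add, ← cl_cl hKH, cl_eq_of_le_stab le_rfl]
  refine dgm_of_convergent hn hK (fun S' n' L h1 h2 h3 => ihc _ h1 _ _ _ h2 h3 rfl) hAS hone hbig
    hsmall ((hAne.add hBne).mono (subset_cl _ _)) (cl_mono hAB) hH.le hKH ?_
  have hk := kneser A (cl H B) hAne (hBne.mono (subset_cl _ _))
  unfold KneserIneq at hk
  rw [← hCH, ← hH, cl_cl le_rfl] at hk
  have hd := ihc _ hlt (S - A.val) (n - 1) H hc'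
    ((le_stab_add_right le_rfl).trans (by rw [← hCH])) rfl
  unfold DGMIneq at hd
  have hA : ∑ x, min 1 #(A ∩ coset H x) ≤ #(cl H A) := by
    have : ∀ x, min 1 #(A ∩ coset H x) ≤ if x ∈ cl H A then 1 else 0 := by
      intro x
      split_ifs with hx
      · exact min_le_left _ _
      · have : A ∩ coset H x = ∅ := by
          refine eq_empty_of_forall_notMem fun y hy => hx ?_
          rw [mem_inter, mem_coset] at hy
          exact mem_cl.2 ⟨y, hy.1, by rw [← H.neg_mem_iff, neg_sub]; exact hy.2⟩
        simp [this]
    refine (sum_le_sum fun x _ => this x).trans ?_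
    simp
  rw [sum_add_distrib]
  obtain ⟨k, rfl⟩ : ∃ k, n = k + 1 := ⟨n - 1, by omega⟩
  rw [add_tsub_cancel_right] at *
  rw [← hB] at hd
  rw [add_mul, ← hC]
  omega

end DeVosGoddynMohar

section Fragments

variable {G : Type u} [AddCommGroup G]

theorem card_inter_add_add_card_union_add (A Y Z : Finset G) :
    #((Y ∩ Z) + A) + #((Y ∪ Z) + A) ≤ #(Y + A) + #(Z + A) := by
  rw [union_add, ← card_union_add_card_inter (Y + A) (Z + A), add_comm]
  exact Nat.add_le_add_left (card_le_card inter_add_subset) _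

theorem card_singleton_add_inter_le_one {X : Finset G}
    (h : ∀ t, t ≠ 0 → #(X ∩ ({t} + X)) ≤ 1) {s t : G} (hst : s ≠ t) :
    #(({s} + X) ∩ ({t} + X)) ≤ 1 := by
  rw [← card_singleton_add (-s) (({s} + X) ∩ ({t} + X))]
  refine le_trans (card_le_card fun x hx => ?_) (h (t - s) (sub_ne_zero.2 hst.symm))
  simp only [mem_singleton_add, mem_inter] at hx ⊢
  refine ⟨by simpa using hx.1, ?_⟩
  convert hx.2 using 1
  abel

theorem eq_or_eq_of_singleton_add_subset {X : Finset G} (hX : 3 ≤ #X)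
    (h : ∀ t, t ≠ 0 → #(X ∩ ({t} + X)) ≤ 1) {p s t : G}
    (hp : {p} + X ⊆ ({s} + X) ∪ ({t} + X)) : p = s ∨ p = t := by
  by_contra hcon
  push Not at hcon
  have h1 := card_singleton_add_inter_le_one h hcon.1
  have h2 := card_singleton_add_inter_le_one h hcon.2
  have h3 : {p} + X ⊆ (({p} + X) ∩ ({s} + X)) ∪ (({p} + X) ∩ ({t} + X)) := by
    rw [← inter_union_distrib_left]
    exact subset_inter subset_rfl hp
  have h4 := card_le_card h3
  have h5 := card_union_le (({p} + X) ∩ ({s} + X)) (({p} + X) ∩ ({t} + X))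
  rw [card_singleton_add] at h4
  omega

variable [Fintype G]

/-- `Z` is a fragment for `A`: its sumset with `A` is small and misses at least two elements. -/
def IsFragment (A Z : Finset G) : Prop :=
  2 ≤ #Z ∧ #(Z + A) + 2 ≤ Fintype.card G ∧ #(Z + A) + 1 ≤ #Z + #A

theorem IsFragment.singleton_add {A Z : Finset G} (h : IsFragment A Z) (t : G) :
    IsFragment A ({t} + Z) := by
  unfold IsFragment at *
  rwa [add_assoc, card_singleton_add, card_singleton_add]

theorem card_neg_compl (Y : Finset G) : #(-Yᶜ) + #Y = Fintype.card G := by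
  rw [card_neg, card_compl]
  have := card_le_univ Y
  omega

theorem IsFragment.dual {A Z : Finset G} (h : IsFragment A Z) : IsFragment A (-(Z + A)ᶜ) := by
  obtain ⟨h1, h2, h3⟩ := h
  have hc := card_neg_compl (Z + A)
  have hs : -(Z + A)ᶜ + A ⊆ -Zᶜ := by
    intro x hx
    obtain ⟨y, hy, a, ha, rfl⟩ := mem_add.1 hx
    rw [mem_neg', mem_compl] at hy ⊢
    refine fun hz => hy (mem_add.2 ⟨_, hz, a, ha, by abel⟩)
  have hc' := card_neg_compl Z
  have := card_le_card hs
  exact ⟨by omega, by omega, by omega⟩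

theorem card_add_le_of_card_lt {A X Y : Finset G} (hmin : ∀ Z, IsFragment A Z → #X ≤ #Z)
    (h2 : 2 ≤ #Y) (hlt : #Y < #X) (hY : #(Y + A) + 2 ≤ Fintype.card G) : #Y + #A ≤ #(Y + A) := by
  by_contra hcon
  have := hmin Y ⟨h2, hY, by omega⟩
  omega

theorem card_inter_singleton_add_le_one {A X : Finset G}
    (hstar : ∀ Z : Finset G, Z.Nonempty → Z + A ≠ univ → #Z + #A ≤ #(Z + A) + 1)
    (hX : IsFragment A X) (hmin : ∀ Z, IsFragment A Z → #X ≤ #Z) {t : G} (ht : t ∉ stab X) :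
    #(X ∩ ({t} + X)) ≤ 1 := by
  by_contra hcon
  have hdual := hmin _ hX.dual
  have hc := card_neg_compl (X + A)
  obtain ⟨h1, h2, h3⟩ := hX
  set I := X ∩ ({t} + X) with hI
  have hIlt : #I < #X := by
    refine card_lt_card ⟨inter_subset_left, fun hle => ht ?_⟩
    have hs : X ⊆ {t} + X := fun x hx => (mem_inter.1 (hle hx)).2
    have he : X = {t} + X := eq_of_subset_of_card_le hs (card_singleton_add _ _).le
    refine mem_stab_of_forall fun x hx => ?_
    rw [he, mem_singleton_add]
    simpa using hx
  have hIA : #(I + A) ≤ #(X + A) := card_le_card (add_subset_add_right inter_subset_left)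
  have h4 := card_add_le_of_card_lt hmin (by omega) hIlt (by omega)
  have h5 := card_inter_add_add_card_union_add A X ({t} + X)
  have h6 := card_union_add_card_inter X ({t} + X)
  rw [card_singleton_add, ← hI] at h6
  rw [add_assoc, card_singleton_add, ← hI] at h5
  by_cases hu : (X ∪ ({t} + X)) + A = univ
  · rw [hu, card_univ] at h5
    omega
  · have hne : (X ∪ ({t} + X)).Nonempty := card_pos.1 (by omega)
    have := hstar _ hne hu
    omega

theorem card_cl_zmultiples_le {A : Finset G} {g : G} (h : #({0, g} + A) ≤ #A + 1) :
    #(cl (AddSubgroup.zmultiples g) A) + 1 ≤ #A + Nat.card (AddSubgroup.zmultiples g) := by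
  let B : ℕ → Finset G := fun j => Nat.rec A (fun _ Y => Y ∪ ({g} + Y)) j
  have hB : ∀ j, B (j + 1) = B j ∪ ({g} + B j) := fun _ => rfl
  have hgap : ∀ j, #(B (j + 1)) ≤ #(B j) + 1 ∧ #(B (j + 1) \ B j) ≤ 1 := by
    have hz : ∀ j, #(B (j + 1) \ B j) ≤ 1 → #(B (j + 1)) ≤ #(B j) + 1 := by
      intro j hj
      have := card_sdiff_add_card_eq_card (hB j ▸ subset_union_left : B j ⊆ B (j + 1))
      omega
    intro j
    suffices #(B (j + 1) \ B j) ≤ 1 from ⟨hz j this, this⟩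
    induction j with
    | zero =>
      have hs : A ⊆ B 1 := hB 0 ▸ subset_union_left
      have := card_sdiff_add_card_eq_card hs
      have h01 : B 1 = {0, g} + A := by
        rw [insert_eq, union_add, singleton_zero, zero_add]
        exact hB 0
      rw [← h01] at h
      change #(B 1 \ A) ≤ 1
      omega
    | succ j ih =>
      refine le_trans ?_ ih
      rw [← card_singleton_add g (B (j + 1) \ B j)]
      refine card_le_card fun x hx => ?_
      rw [mem_sdiff] at hx
      rw [mem_singleton_add, mem_sdiff]
      have h1 : x - g ∈ B (j + 1) := by
        rw [hB (j + 1), mem_union, mem_singleton_add] at hx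
        exact hx.1.resolve_left hx.2
      refine ⟨h1, fun h2 => hx.2 ?_⟩
      rw [hB j, mem_union, mem_singleton_add]
      exact Or.inr h2
  have hcard : ∀ j, #(B j) ≤ #A + j := by
    intro j
    induction j with
    | zero => exact le_rfl
    | succ j ih => have := (hgap j).1; omega
  have hmem : ∀ j, ∀ i ≤ j, ∀ a ∈ A, i • g + a ∈ B j := by
    intro j
    induction j with
    | zero =>
      intro i hi a ha
      obtain rfl : i = 0 := by omega
      change _ ∈ A
      simpa using ha
    | succ j ih =>
      intro i hi a ha
      rw [hB, mem_union, mem_singleton_add]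
      rcases Nat.lt_or_ge j i with hij | hij
      · obtain rfl : i = j + 1 := by omega
        right
        convert ih j le_rfl a ha using 1
        rw [succ_nsmul]
        abel
      · exact Or.inl (ih i hij a ha)
  have hpos := Nat.card_pos (α := AddSubgroup.zmultiples g)
  have hsub : cl (AddSubgroup.zmultiples g) A ⊆ B (Nat.card (AddSubgroup.zmultiples g) - 1) := by
    intro x hx
    obtain ⟨a, ha, hxa⟩ := mem_cl.1 hx
    obtain ⟨i, hi, hia⟩ := (mem_zmultiples_iff_mem_range_addOrderOf).1 hxa |> mem_image.1
    rw [Finset.mem_range, ← Nat.card_zmultiples] at hi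
    have := hmem _ i (by omega : i ≤ Nat.card (AddSubgroup.zmultiples g) - 1) a ha
    rw [hia] at this
    simpa using this
  have := (card_le_card hsub).trans (hcard _)
  omega

theorem exists_mem_iff_of_card_add_add_one {A F : Finset G} (h : #(F + A) + 1 = Fintype.card G)
    (hF : #F + #A = Fintype.card G) : ∃ y, ∀ x, x ∈ F ↔ y - x ∉ A := by
  obtain ⟨y, hy⟩ : ∃ y, y ∉ F + A := by
    by_contra hcon
    push Not at hcon
    rw [eq_univ_iff_forall.2 hcon, card_univ] at h
    omega
  refine ⟨y, fun x => ?_⟩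
  have hs : F ⊆ univ.filter fun x => y - x ∉ A := by
    intro x hx
    simp only [mem_filter, mem_univ, true_and]
    exact fun ha => hy (mem_add.2 ⟨x, hx, _, ha, by abel⟩)
  have hc : #(univ.filter fun x => y - x ∉ A) = #F := by
    have h1 : (univ.filter fun x => y - x ∉ A) = (A.image fun a => y - a)ᶜ := by
      ext x
      simp only [mem_filter, mem_univ, true_and, mem_compl, mem_image, not_iff_not]
      exact ⟨fun ha => ⟨_, ha, by abel⟩, by rintro ⟨a, ha, rfl⟩; simpa using ha⟩
    rw [h1, card_compl, card_image_of_injective _ sub_right_injective]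
    omega
  rw [eq_of_subset_of_card_le hs hc.le]
  simp

theorem fragment_card_lt_three {A X : Finset G}
    (hstar : ∀ Z : Finset G, Z.Nonempty → Z + A ≠ univ → #Z + #A ≤ #(Z + A) + 1)
    (hX : IsFragment A X) (hmin : ∀ Z, IsFragment A Z → #X ≤ #Z) (h0 : (0 : G) ∈ X)
    (hper : stab X = ⊥) : #X < 3 := by
  by_contra hk
  push Not at hk
  have hF2 : ∀ t, t ≠ 0 → #(X ∩ ({t} + X)) ≤ 1 := fun t ht =>
    card_inter_singleton_add_le_one hstar hX hmin (by rwa [hper, AddSubgroup.mem_bot])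
  have hdual := hmin _ hX.dual
  have hc := card_neg_compl (X + A)
  have hXA := hstar X (card_pos.1 (by omega)) fun h => by
    have := hX.2.1
    rw [h, card_univ] at this
    omega
  have hX' := hX
  obtain ⟨h1, h2, h3⟩ := hX'
  have key : ∀ a ∈ X, a ≠ 0 → 4 ≤ #X ∧ ∃ y, ∀ x, x ∈ X ∪ ({a} + X) ↔ y - x ∉ A := by
    intro a ha ha0
    have haI : a ∈ X ∩ ({a} + X) := mem_inter.2 ⟨ha, by rw [mem_singleton_add]; simpa using h0⟩
    have hI : X ∩ ({a} + X) = {a} :=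
      (eq_of_subset_of_card_le (singleton_subset_iff.2 haI) (by simpa using hF2 a ha0)).symm
    set F := X ∪ ({a} + X) with hF
    have e1 := card_union_add_card_inter X ({a} + X)
    have e2 := card_inter_add_add_card_union_add A X ({a} + X)
    rw [hI, card_singleton, card_singleton_add, ← hF] at e1
    rw [hI, card_singleton_add, add_assoc, card_singleton_add, ← hF] at e2
    have hFA := hstar F (card_pos.1 (by omega)) fun h => by
      rw [h, card_univ] at e2
      omega
    obtain ⟨b, hb, hb'⟩ : ∃ b ∈ X, b ∉ ({0, a} : Finset G) := by
      by_contra hcon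
      push Not at hcon
      have := (card_le_card hcon).trans card_le_two
      omega
    simp only [mem_insert, mem_singleton, not_or] at hb'
    set I := F ∩ ({b} + X) with hI'
    have hpair : ({b, a + b} : Finset G) ⊆ I := by
      intro x hx
      simp only [mem_insert, mem_singleton] at hx
      rw [hI', mem_inter, hF, mem_union, mem_singleton_add, mem_singleton_add]
      rcases hx with rfl | rfl
      · exact ⟨Or.inl hb, by simpa using h0⟩
      · exact ⟨Or.inr (by simpa using hb), by simpa using ha⟩
    have hpc : #({b, a + b} : Finset G) = 2 := card_pair (by simpa using ha0)
    have hI2 := card_le_card hpair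
    have hI3 : #I ≤ 2 := by
      have hs : I ⊆ (X ∩ ({b} + X)) ∪ (({a} + X) ∩ ({b} + X)) := by
        rw [← union_inter_distrib_right]
      have e3 := card_le_card hs
      have e4 := card_union_le (X ∩ ({b} + X)) (({a} + X) ∩ ({b} + X))
      have e5 := hF2 b hb'.1
      have e6 := card_singleton_add_inter_le_one hF2 (Ne.symm hb'.2)
      omega
    have hIX : #(I + A) ≤ #(X + A) := by
      have := card_le_card (add_subset_add (inter_subset_right : I ⊆ {b} + X) (Subset.refl A))
      rwa [add_assoc, card_singleton_add] at this
    have hIA := card_add_le_of_card_lt hmin (by omega : 2 ≤ #I) (by omega) (by omega)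
    have e7 := card_union_add_card_inter F ({b} + X)
    have e8 := card_inter_add_add_card_union_add A F ({b} + X)
    rw [card_singleton_add, ← hI'] at e7
    rw [← hI', add_assoc, card_singleton_add] at e8
    have hU : F ∪ ({b} + X) + A = univ := by
      by_contra hne
      have := hstar _ (card_pos.1 (by omega)) hne
      omega
    rw [hU, card_univ] at e8
    have hcF := card_neg_compl (F + A)
    have hone : #(F + A) + 1 = Fintype.card G := by
      by_contra hne
      have hfr : IsFragment A F := ⟨by omega, by omega, by omega⟩
      have := hmin _ hfr.dual
      omega
    exact ⟨by omega, exists_mem_iff_of_card_add_add_one hone (by omega)⟩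
  have opp : ∀ a ∈ X, ∀ b ∈ X, a ≠ 0 → b ≠ 0 → a ≠ b → b = -a := by
    intro a ha b hb ha0 hb0 hab
    obtain ⟨-, y, hy⟩ := key a ha ha0
    obtain ⟨-, z, hz⟩ := key b hb hb0
    have hcov : ∀ x, x ∈ X ∪ ({b} + X) → x ∈ ({z - y} + X) ∪ ({z - y + a} + X) := by
      intro x hx
      have h4 : x - (z - y) ∈ X ∪ ({a} + X) := by
        rw [hy]
        rw [hz] at hx
        convert hx using 2
        abel
      rw [mem_union, mem_singleton_add] at h4
      rw [mem_union, mem_singleton_add, mem_singleton_add, ← sub_sub]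
      exact h4
    have c1 := eq_or_eq_of_singleton_add_subset (p := 0) hk hF2 fun x hx =>
      hcov x (mem_union_left _ (by rw [mem_singleton_add] at hx; simpa using hx))
    have c2 := eq_or_eq_of_singleton_add_subset (p := b) hk hF2 fun x hx =>
      hcov x (mem_union_right _ hx)
    rcases c1 with c1 | c1
    · rw [← c1, zero_add] at c2
      rcases c2 with c2 | c2
      · exact absurd c2 hb0
      · exact absurd c2.symm hab
    · rw [← c1] at c2
      rcases c2 with c2 | c2
      · rw [c2]
        exact eq_neg_of_add_eq_zero_left c1.symm
      · exact absurd c2 hb0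
  obtain ⟨a, ha, ha0⟩ := exists_mem_ne (by omega : 1 < #X) 0
  have h4 := (key a ha ha0).1
  have big : ∀ Y : Finset G, #Y ≤ 3 → ∃ b ∈ X, b ∉ Y := by
    intro Y hY
    by_contra hcon
    push Not at hcon
    have := card_le_card hcon
    omega
  obtain ⟨b, hb, hb'⟩ := big {0, a} (card_le_two.trans (by omega))
  obtain ⟨d, hd, hd'⟩ := big {0, a, b} card_le_three
  simp only [mem_insert, mem_singleton, not_or] at hb' hd'
  rw [opp a ha b hb ha0 hb'.1 (Ne.symm hb'.2)] at hd'
  exact hd'.2.2 (opp a ha d hd ha0 hd'.1 (Ne.symm hd'.2.1))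

/-- If some set has a small sumset with `A`, then `A` nearly fills its closure under a nontrivial
subgroup. -/
theorem exists_subgroup_of_card_add_lt {A R : Finset G} (hA : 2 ≤ #A) (hR : 2 ≤ #R)
    (h1 : #(R + A) + 2 ≤ Fintype.card G) (h2 : #(R + A) + 1 ≤ #R + #A) :
    ∃ L : AddSubgroup G, L ≠ ⊥ ∧ #(cl L A) + 1 ≤ #A + Nat.card L ∧
      (L ≠ ⊤ ∨ ∃ a g, a ∈ A ∧ a + g ∈ A ∧ L = AddSubgroup.zmultiples g) := by
  by_cases hstar : ∀ Z : Finset G, Z.Nonempty → Z + A ≠ univ → #Z + #A ≤ #(Z + A) + 1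
  swap
  · push Not at hstar
    obtain ⟨Z, hZ, hu, hlt⟩ := hstar
    have hAne : A.Nonempty := card_pos.1 (by omega)
    have hk := kneser Z A hZ hAne
    unfold KneserIneq at hk
    have h3 := card_le_card (subset_cl (stab (Z + A)) Z)
    refine ⟨stab (Z + A), fun hbot => ?_, by omega, Or.inl fun htop => hu ?_⟩
    · rw [hbot, cl_bot, cl_bot, AddSubgroup.card_bot] at hk
      omega
    · exact eq_univ_of_top_le_stab (hZ.add hAne) htop.ge
  obtain ⟨Y, hY, hYmin⟩ := exists_min_image (univ.filter (IsFragment A)) card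
    ⟨R, by simpa using ⟨hR, h1, h2⟩⟩
  simp only [mem_filter, mem_univ, true_and] at hY hYmin
  obtain ⟨y, hy⟩ : Y.Nonempty := card_pos.1 (by have := hY.1; omega)
  set X := {-y} + Y with hXdef
  have hX : IsFragment A X := hY.singleton_add (-y)
  have hmin : ∀ Z, IsFragment A Z → #X ≤ #Z := by
    intro Z hZ
    rw [hXdef, card_singleton_add]
    exact hYmin Z hZ
  have h0 : (0 : G) ∈ X := by
    rw [hXdef, mem_singleton_add]
    simpa using hy
  clear_value X
  have hX' := hX
  obtain ⟨e1, e2, e3⟩ := hX'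
  by_cases hper : stab X = ⊥
  · have hk := fragment_card_lt_three hstar hX hmin h0 hper
    obtain ⟨g, hg, hg0⟩ := exists_mem_ne (by omega : 1 < #X) 0
    have hXg : X = {0, g} := by
      refine (eq_of_subset_of_card_le ?_ ?_).symm
      · intro x hx
        simp only [mem_insert, mem_singleton] at hx
        rcases hx with rfl | rfl
        exacts [h0, hg]
      · rw [card_pair hg0.symm]
        omega
    rw [hXg] at e3
    rw [card_pair hg0.symm] at e3
    refine ⟨AddSubgroup.zmultiples g, by simpa using hg0, card_cl_zmultiples_le (by omega),
      Or.inr ?_⟩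
    by_contra hcon
    push Not at hcon
    have hd : Disjoint A ({g} + A) := by
      rw [Finset.disjoint_left]
      intro x hx hx'
      rw [mem_singleton_add] at hx'
      exact hcon (x - g) g hx' (by simpa using hx) rfl
    rw [insert_eq, union_add, singleton_zero, zero_add, card_union_of_disjoint hd,
      card_singleton_add] at e3
    omega
  · obtain ⟨t, ht, ht0⟩ := AddSubgroup.ne_bot_iff_exists_ne_zero.1 hper |>.elim
      fun t ht => (⟨t.1, t.2, fun h => ht (Subtype.ext h)⟩ : ∃ t, t ∈ stab X ∧ t ≠ 0)
    have hXs : ∀ x ∈ X, x ∈ stab X := by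
      intro x hx
      by_contra hxs
      have := card_inter_singleton_add_le_one hstar hX hmin hxs
      refine ht0 ?_
      have m1 : x ∈ X ∩ ({x} + X) := mem_inter.2 ⟨hx, by rw [mem_singleton_add]; simpa using h0⟩
      have m2 : t + x ∈ X ∩ ({x} + X) := by
        rw [mem_inter, mem_singleton_add]
        exact ⟨(ht x).2 hx, by simpa using (ht 0).2 h0⟩
      simpa using card_le_one.1 this _ m2 _ m1
    have hXc : X = coset (stab X) 0 := by
      refine subset_antisymm (fun x hx => ?_) (coset_subset le_rfl h0)
      simpa [mem_coset] using hXs x hx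
    have hcard : #X = Nat.card (stab X) := by
      conv_lhs => rw [hXc]
      exact card_coset _ _
    have hcl : cl (stab X) A ⊆ X + A := by
      intro x hx
      obtain ⟨a, ha, hxa⟩ := mem_cl.1 hx
      refine mem_add.2 ⟨x - a, ?_, a, ha, by abel⟩
      rw [hXc, mem_coset]
      simpa using hxa
    have := card_le_card hcl
    refine ⟨stab X, hper, by omega, Or.inl fun htop => ?_⟩
    rw [eq_univ_of_top_le_stab ⟨0, h0⟩ htop.ge] at e2
    have hAne : A.Nonempty := card_pos.1 (by omega)
    have := card_le_card_add_right (s := (univ : Finset G)) hAne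
    rw [card_univ] at this
    omega

end Fragments

section Iterated

variable {G : Type u} [AddCommGroup G]

/-- The `n`-fold sumset of `A`. -/
noncomputable def iter (A : Finset G) : ℕ → Finset G
  | 0 => 0
  | n + 1 => A + iter A n

theorem mem_iter {A : Finset G} {n : ℕ} {x : G} :
    x ∈ iter A n ↔ ∃ T : Multiset G, (∀ y ∈ T, y ∈ A) ∧ Multiset.card T = n ∧ T.sum = x := by
  induction n generalizing x with
  | zero =>
    simp only [iter, mem_zero, Multiset.card_eq_zero]
    constructor
    · rintro rfl
      exact ⟨0, by simp, rfl, by simp⟩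
    · rintro ⟨T, -, rfl, rfl⟩
      simp
  | succ n ih =>
    simp only [iter, mem_add]
    constructor
    · rintro ⟨a, ha, y, hy, rfl⟩
      obtain ⟨T, h1, h2, h3⟩ := ih.1 hy
      refine ⟨a ::ₘ T, ?_, by simp [h2], by simp [h3]⟩
      intro z hz
      rcases Multiset.mem_cons.1 hz with rfl | hz
      exacts [ha, h1 z hz]
    · rintro ⟨T, h1, h2, rfl⟩
      obtain ⟨a, ha⟩ := Multiset.card_pos_iff_exists_mem.1 (by omega : 0 < Multiset.card T)
      obtain ⟨T, rfl⟩ := Multiset.exists_cons_of_mem ha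
      exact ⟨a, h1 a ha, T.sum, ih.2 ⟨T, fun y hy => h1 y (Multiset.mem_cons_of_mem hy),
        by simpa using h2, rfl⟩, by simp⟩

theorem iter_one (A : Finset G) : iter A 1 = A := by
  simp [iter]

theorem iter_nonempty {A : Finset G} (hA : A.Nonempty) (n : ℕ) : (iter A n).Nonempty := by
  induction n with
  | zero => exact ⟨0, by simp [iter]⟩
  | succ n ih => exact hA.add ih

theorem card_iter_le_succ {A : Finset G} (hA : A.Nonempty) (n : ℕ) :
    #(iter A n) ≤ #(iter A (n + 1)) :=
  card_le_card_add_left hA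

theorem card_iter_mono {A : Finset G} (hA : A.Nonempty) : Monotone fun n => #(iter A n) :=
  monotone_nat_of_le_succ (card_iter_le_succ hA)

theorem image_mk_iter (H : AddSubgroup G) (A : Finset G) (n : ℕ) :
    (iter A n).image (QuotientAddGroup.mk' H) = iter (A.image (QuotientAddGroup.mk' H)) n := by
  induction n with
  | zero =>
    ext
    simp [iter]
  | succ n ih =>
    rw [iter, iter, image_add, ih]
    congr!

variable [Fintype G]

theorem card_le_card_mul_card_image_mk (H : AddSubgroup G) (A : Finset G) :
    #A ≤ Nat.card H * #(A.image (QuotientAddGroup.mk' H)) := by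
  refine card_le_mul_card_image A _ fun q hq => ?_
  obtain ⟨a, -, rfl⟩ := mem_image.1 hq
  refine card_le_of_forall_sub_mem (a := a) fun x hx => ?_
  exact (QuotientAddGroup.eq_iff_sub_mem).1 (mem_filter.1 hx).2

theorem exists_card_iter_add_lt {A : Finset G} {n : ℕ} (hn : 2 ≤ n)
    (h : #(iter A (n - 1)) + #A ≤ Fintype.card G) (hc : Fintype.card G < #A * n) :
    ∃ j, 1 ≤ j ∧ j + 1 ≤ n - 1 ∧ #(iter A j + A) + 1 ≤ #(iter A j) + #A := by
  by_contra hcon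
  push Not at hcon
  have key : ∀ j, j + 1 ≤ n - 1 → #A * (j + 1) ≤ #(iter A (j + 1)) := by
    intro j hj
    induction j with
    | zero => simp [iter_one]
    | succ j ih =>
      have h1 := hcon (j + 1) (by omega) (by omega)
      have h2 := ih (by omega)
      rw [add_comm _ A] at h1
      change _ < #(iter A (j + 1 + 1)) + 1 at h1
      rw [mul_add_one]
      omega
  obtain ⟨k, rfl⟩ := Nat.exists_eq_add_of_le hn
  have := key k (by omega)
  rw [show 2 + k - 1 = k + 1 by omega] at h
  nlinarith

theorem exists_add_eq_of_card_lt {L : AddSubgroup G} {A : Finset G} {a b u : G}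
    (h : Nat.card L < #(A ∩ coset L a) + #(A ∩ coset L b)) (hu : u - (a + b) ∈ L) :
    ∃ x ∈ A, ∃ y ∈ A, x + y = u := by
  have h1 : #((A ∩ coset L b).image (u - ·)) = #(A ∩ coset L b) :=
    card_image_of_injective _ sub_right_injective
  have h2 : (A ∩ coset L b).image (u - ·) ⊆ coset L a := by
    intro z hz
    obtain ⟨y, hy, rfl⟩ := mem_image.1 hz
    have := L.sub_mem hu (mem_coset.1 (mem_inter.1 hy).2)
    rw [mem_coset]
    convert this using 1
    abel
  obtain ⟨z, hz⟩ := inter_nonempty_of_card_lt_card_add_card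
    (inter_subset_right : A ∩ coset L a ⊆ _) h2 (by rw [card_coset, h1]; exact h)
  obtain ⟨hz1, hz2⟩ := mem_inter.1 hz
  obtain ⟨y, hy, rfl⟩ := mem_image.1 hz2
  exact ⟨_, (mem_inter.1 hz1).1, y, (mem_inter.1 hy).1, by simp⟩

theorem mem_iter_of_card_lt {L : AddSubgroup G} {A : Finset G} {a b x : G} {T : Multiset G}
    (h : Nat.card L < #(A ∩ coset L a) + #(A ∩ coset L b)) (hT : ∀ y ∈ T, y ∈ A)
    (hx : x - (a ::ₘ b ::ₘ T).sum ∈ L) : x ∈ iter A (Multiset.card T + 2) := by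
  obtain ⟨y, hy, z, hz, hyz⟩ := exists_add_eq_of_card_lt (u := x - T.sum) h
    (by convert hx using 1; simp only [Multiset.sum_cons]; abel)
  refine mem_iter.2 ⟨y ::ₘ z ::ₘ T, ?_, by simp, ?_⟩
  · intro w hw
    rcases Multiset.mem_cons.1 hw with rfl | hw
    · exact hy
    rcases Multiset.mem_cons.1 hw with rfl | hw
    exacts [hz, hT w hw]
  · rw [Multiset.sum_cons, Multiset.sum_cons, ← add_assoc, hyz]
    abel

theorem card_lt_of_sub_notMem {L : AddSubgroup G} {A : Finset G} {a b : G}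
    (hcl : #(cl L A) + 1 ≤ #A + Nat.card L) (ha : a ∈ A) (hb : b ∈ A) (hab : a - b ∉ L) :
    Nat.card L < #(A ∩ coset L a) + #(A ∩ coset L b) := by
  have hd : Disjoint (coset L a) (coset L b) := by
    rw [Finset.disjoint_left]
    intro x hx hx'
    refine hab ?_
    have := L.sub_mem (mem_coset.1 hx') (mem_coset.1 hx)
    simpa using this
  have hs : (coset L a ∪ coset L b) ∪ A ⊆ cl L A :=
    union_subset (union_subset (coset_subset (le_stab_cl _ _) (subset_cl _ _ ha))
      (coset_subset (le_stab_cl _ _) (subset_cl _ _ hb))) (subset_cl _ _)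
  have h1 := card_union_add_card_inter (coset L a ∪ coset L b) A
  have h2 := card_le_card hs
  have h3 := card_union_of_disjoint hd
  rw [card_coset, card_coset] at h3
  have h4 : (coset L a ∪ coset L b) ∩ A = (A ∩ coset L a) ∪ (A ∩ coset L b) := by
    rw [inter_comm, inter_union_distrib_left]
  have h5 := card_union_le (A ∩ coset L a) (A ∩ coset L b)
  rw [h4] at h1
  omega

theorem mem_iter_of_add_mem {A : Finset G} {a g x : G} {n : ℕ} (ha : a ∈ A) (hag : a + g ∈ A)
    (hn : addOrderOf g ≤ n) (hg : AddSubgroup.zmultiples g = ⊤) : x ∈ iter A n := by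
  have hx : x - n • a ∈ AddSubgroup.zmultiples g := by rw [hg]; trivial
  have hfin : IsOfFinAddOrder g := isOfFinAddOrder_of_finite g
  rw [← hfin.mem_multiples_iff_mem_zmultiples, hfin.mem_multiples_iff_mem_range_addOrderOf] at hx
  obtain ⟨k, hk, hkx⟩ := mem_image.1 hx
  rw [mem_range] at hk
  refine mem_iter.2 ⟨Multiset.replicate k (a + g) + Multiset.replicate (n - k) a, ?_, ?_, ?_⟩
  · intro y hy
    rcases Multiset.mem_add.1 hy with hy | hy
    · rwa [Multiset.eq_of_mem_replicate hy]
    · rwa [Multiset.eq_of_mem_replicate hy]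
  · simp
    omega
  · have h1 : n • a = k • a + (n - k) • a := by
      rw [← add_nsmul]
      congr 1
      omega
    rw [Multiset.sum_add, Multiset.sum_replicate, Multiset.sum_replicate, nsmul_add, hkx, h1]
    abel

theorem mem_iter_of_exists_sub_mem {L : AddSubgroup G} {A : Finset G} {n : ℕ} (hn : 2 ≤ n)
    (hexp : AddMonoid.exponent G ≤ n) (hgen : ∀ a, ∃ x ∈ A, x - a ∉ L)
    (hcl : #(cl L A) + 1 ≤ #A + Nat.card L) {x y : G} (hy : y ∈ iter A n) (hxy : x - y ∈ L) :
    x ∈ iter A n := by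
  obtain ⟨T, hT, hTn, rfl⟩ := mem_iter.1 hy
  obtain ⟨a, ha⟩ := Multiset.card_pos_iff_exists_mem.1 (by omega : 0 < Multiset.card T)
  have haA := hT a ha
  by_cases hall : ∃ b ∈ T, a - b ∉ L
  · obtain ⟨b, hb, hab⟩ := hall
    obtain ⟨T, rfl⟩ := Multiset.exists_cons_of_mem ha
    have hb' : b ∈ T := by
      rcases Multiset.mem_cons.1 hb with rfl | hb
      · exact absurd (by simp) hab
      · exact hb
    have hbA := hT b hb
    obtain ⟨T, rfl⟩ := Multiset.exists_cons_of_mem hb'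
    have := mem_iter_of_card_lt (card_lt_of_sub_notMem hcl haA hbA hab)
      (fun y hy => hT y (by simp [hy])) hxy
    rwa [show Multiset.card T + 2 = n by simpa using hTn] at this
  push Not at hall
  have hsum : ((T.sum : G) : G ⧸ L) = n • (a : G ⧸ L) := by
    rw [← hTn]
    refine mk_sum_eq_nsmul fun y hy => ?_
    rw [eq_comm]
    exact QuotientAddGroup.eq_iff_sub_mem.2 (hall y hy)
  obtain ⟨b, hbA, hba⟩ := hgen a
  by_cases hgood : Nat.card L < #(A ∩ coset L a) + #(A ∩ coset L a)
  · have := mem_iter_of_card_lt (x := x) (T := Multiset.replicate (n - 2) a) hgood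
      (fun y hy => by rwa [Multiset.eq_of_mem_replicate hy]) (by
        rw [← QuotientAddGroup.eq_iff_sub_mem, QuotientAddGroup.eq_iff_sub_mem.2 hxy, hsum]
        rw [← Multiset.replicate_succ, ← Multiset.replicate_succ, Multiset.sum_replicate]
        rw [show n - 2 + 1 + 1 = n by omega]
        rfl)
    rwa [show Multiset.card (Multiset.replicate (n - 2) a) + 2 = n by simp; omega] at this
  · have h1 := card_lt_of_sub_notMem hcl hbA haA hba
    have hfin : IsOfFinAddOrder (((b - a : G)) : G ⧸ L) := isOfFinAddOrder_of_finite _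
    set o := addOrderOf ((b - a : G) : G ⧸ L) with ho
    have ho0 : 0 < o := hfin.addOrderOf_pos
    have ho1 : o ≠ 1 := by
      rw [ho, Ne, AddMonoid.addOrderOf_eq_one_iff, QuotientAddGroup.eq_zero_iff]
      exact hba
    have hon : o ≤ n := by
      refine le_trans (Nat.le_of_dvd ?_ ?_) hexp
      · exact Nat.pos_of_ne_zero AddMonoid.exponent_ne_zero_of_finite
      · exact (AddMonoid.addOrder_dvd_exponent _).trans (AddGroup.exponent_quotient_dvd L)
    have := mem_iter_of_card_lt (x := x) (a := b) (b := b)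
      (T := Multiset.replicate (o - 2) b + Multiset.replicate (n - o) a) (L := L) (A := A)
      (by omega)
      (fun y hy => by
        rcases Multiset.mem_add.1 hy with hy | hy
        · rwa [Multiset.eq_of_mem_replicate hy]
        · rwa [Multiset.eq_of_mem_replicate hy]) (by
        rw [← QuotientAddGroup.eq_iff_sub_mem, QuotientAddGroup.eq_iff_sub_mem.2 hxy, hsum]
        rw [← Multiset.cons_add, ← Multiset.cons_add, ← Multiset.replicate_succ,
          ← Multiset.replicate_succ, Multiset.sum_add, Multiset.sum_replicate,
          Multiset.sum_replicate]
        rw [show o - 2 + 1 + 1 = o by omega]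
        have h2 : o • ((b - a : G) : G ⧸ L) = 0 := addOrderOf_nsmul_eq_zero _
        have h3 : o • (b : G ⧸ L) = o • (a : G ⧸ L) := by
          rwa [QuotientAddGroup.mk_sub, nsmul_sub, sub_eq_zero] at h2
        rw [QuotientAddGroup.mk_add, QuotientAddGroup.mk_nsmul, QuotientAddGroup.mk_nsmul, h3,
          ← add_nsmul]
        congr 1
        omega)
    rwa [show Multiset.card (Multiset.replicate (o - 2) b + Multiset.replicate (n - o) a) + 2 = n by
      simp; omega] at this

end Iterated

/-- A set that is not contained in a coset of a proper subgroup has full `n`-fold sumset as soon as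
`n` is at least the exponent and `|G| < n |A|`. -/
theorem iter_eq_univ (N : ℕ) : ∀ {G : Type u} [AddCommGroup G] [Fintype G], Fintype.card G = N →
    ∀ {A : Finset G} {n : ℕ}, A.Nonempty →
    (∀ H : AddSubgroup G, ∀ a, (∀ x ∈ A, x - a ∈ H) → H = ⊤) → AddMonoid.exponent G ≤ n →
    Fintype.card G < #A * n → iter A n = univ := by
  induction N using Nat.strong_induction_on with
  | _ N ih =>
  intro G _ _ hN A n hA hgen hexp hc
  by_cases hA2 : #A ≤ 1
  · obtain ⟨a, ha⟩ := hA
    have htop := hgen ⊥ a fun x hx => by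
      rw [AddSubgroup.mem_bot, sub_eq_zero]
      exact card_le_one.1 hA2 x hx a ha
    obtain ⟨y, hy⟩ := iter_nonempty ⟨a, ha⟩ n
    refine eq_univ_of_top_le_stab ⟨y, hy⟩ ?_
    rw [← htop]
    exact bot_le
  push Not at hA2
  refine eq_univ_of_forall fun x => ?_
  by_contra hx
  have hn2 : 2 ≤ n := by
    by_contra hcon
    have := card_le_univ A
    interval_cases n <;> omega
  have hdis : Disjoint (iter A (n - 1)) (A.image (x - ·)) := by
    rw [Finset.disjoint_left]
    intro y hy hy'
    obtain ⟨a, ha, rfl⟩ := mem_image.1 hy'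
    refine hx ?_
    obtain ⟨k, rfl⟩ := Nat.exists_eq_add_of_le hn2
    have : a + (x - a) ∈ iter A (k + 1 + 1) :=
      add_mem_add ha (by rwa [show 2 + k - 1 = k + 1 by omega] at hy)
    rw [show 2 + k = k + 1 + 1 by omega]
    simpa using this
  have hle : #(iter A (n - 1)) + #A ≤ Fintype.card G := by
    have h1 := card_le_univ (iter A (n - 1) ∪ A.image (x - ·))
    rwa [card_union_of_disjoint hdis, card_image_of_injective _ sub_right_injective] at h1
  obtain ⟨j, hj1, hj2, hj⟩ := exists_card_iter_add_lt hn2 hle hc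
  have m1 : #(iter A 1) ≤ #(iter A j) := card_iter_mono hA hj1
  have m2 : #(iter A (j + 1)) ≤ #(iter A (n - 1)) := card_iter_mono hA hj2
  have m3 : iter A (j + 1) = iter A j + A := add_comm _ _
  rw [iter_one] at m1
  rw [m3] at m2
  obtain ⟨L, hL0, hLcl, hL⟩ := exists_subgroup_of_card_add_lt (A := A) (R := iter A j)
    (by omega) (by omega) (by omega) (by omega)
  by_cases hLt : L = ⊤
  · rcases hL with hL | ⟨a, g, ha, hag, hLg⟩
    · exact hL hLt
    refine hx (mem_iter_of_add_mem ha hag (le_trans (Nat.le_of_dvd ?_ ?_) hexp)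
      (hLg.symm.trans hLt))
    · exact Nat.pos_of_ne_zero AddMonoid.exponent_ne_zero_of_finite
    · exact AddMonoid.addOrder_dvd_exponent _
  have hcard := AddSubgroup.card_eq_card_quotient_mul_card_addSubgroup L
  rw [Nat.card_eq_fintype_card, Nat.card_eq_fintype_card (α := G ⧸ L)] at hcard
  have hLc : 1 < Nat.card L := by
    rw [← AddSubgroup.one_lt_card_iff_ne_bot] at hL0
    exact hL0
  have hQ0 : 0 < Fintype.card (G ⧸ L) := Fintype.card_pos
  have hexpQ : AddMonoid.exponent (G ⧸ L) ≤ n :=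
    (Nat.le_of_dvd (Nat.pos_of_ne_zero AddMonoid.exponent_ne_zero_of_finite)
      (AddGroup.exponent_quotient_dvd L)).trans hexp
  have himg := card_le_card_mul_card_image_mk L A
  have hmain := ih (Fintype.card (G ⧸ L)) (by nlinarith) (G := G ⧸ L) rfl
    (A := A.image (QuotientAddGroup.mk' L)) (n := n) (hA.image _) (by
      intro H a hH
      obtain ⟨a, rfl⟩ := QuotientAddGroup.mk'_surjective L a
      have := hgen (H.comap (QuotientAddGroup.mk' L)) a fun x hx => by
        rw [AddSubgroup.mem_comap, map_sub]
        exact hH _ (mem_image_of_mem _ hx)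
      rw [eq_top_iff]
      intro q _
      obtain ⟨q, rfl⟩ := QuotientAddGroup.mk'_surjective L q
      rw [← AddSubgroup.mem_comap, this]
      trivial) hexpQ (by
      by_contra hcon
      push Not at hcon
      have := Nat.mul_le_mul_left (Nat.card L) hcon
      nlinarith)
  rw [← image_mk_iter] at hmain
  obtain ⟨y, hy, hyx⟩ := mem_image.1 (hmain ▸ mem_univ (QuotientAddGroup.mk' L x))
  refine hx (mem_iter_of_exists_sub_mem hn2 hexp ?_ hLcl hy
    (QuotientAddGroup.eq_iff_sub_mem.1 hyx.symm))
  intro a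
  by_contra hcon
  push Not at hcon
  exact hLt (hgen L a hcon)

section Assembly

variable {G : Type u} [AddCommGroup G] [Fintype G]

theorem iter_subset_coset {A : Finset G} {K : AddSubgroup G} {a : G} (hK : ∀ x ∈ A, x - a ∈ K)
    (m : ℕ) : iter A m ⊆ coset K (m • a) := by
  induction m with
  | zero => simp [iter, mem_coset]
  | succ m ih =>
    intro x hx
    obtain ⟨y, hy, z, hz, rfl⟩ := mem_add.1 hx
    have := K.add_mem (hK y hy) (mem_coset.1 (ih hz))
    rw [mem_coset, succ_nsmul]
    convert this using 1
    abel

/-- Olson's lower bound for iterated sumsets. -/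
theorem iter_eq_coset_or_le {A : Finset G} {K : AddSubgroup G} {a : G} (ha : a ∈ A)
    (hK : ∀ x ∈ A, x - a ∈ K) (hmin : ∀ H : AddSubgroup G, (∀ x ∈ A, x - a ∈ H) → K ≤ H) (m : ℕ) :
    iter A (m + 1) = coset K ((m + 1) • a) ∨ #A * (m + 2) ≤ 2 * #(iter A (m + 1)) := by
  induction m with
  | zero =>
    right
    rw [iter_one]
    omega
  | succ m ih =>
    have hfull : K ≤ stab (iter A (m + 1 + 1)) →
        iter A (m + 1 + 1) = coset K ((m + 1 + 1) • a) := by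
      intro h
      obtain ⟨y, hy⟩ := iter_nonempty ⟨a, ha⟩ (m + 1 + 1)
      have hsub := iter_subset_coset hK (m + 1 + 1)
      refine eq_of_subset_of_card_le hsub ?_
      rw [card_coset, ← card_coset K y]
      exact card_le_card (coset_subset h hy)
    rcases ih with ih | ih
    · refine Or.inl (hfull ?_)
      rw [iter, ih]
      exact le_stab_add_right (le_stab_coset _ _)
    have hk := kneser A (iter A (m + 1)) ⟨a, ha⟩ (iter_nonempty ⟨a, ha⟩ _)
    unfold KneserIneq at hk
    set L := stab (A + iter A (m + 1)) with hL
    by_cases hAL : ∀ x ∈ A, x - a ∈ L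
    · exact Or.inl (hfull (hmin _ hAL))
    right
    push Not at hAL
    obtain ⟨b, hb, hba⟩ := hAL
    have hd : Disjoint (coset L a) (coset L b) := by
      rw [Finset.disjoint_left]
      intro x hx hx'
      refine hba ?_
      have := L.sub_mem (mem_coset.1 hx) (mem_coset.1 hx')
      simpa using this
    have h1 := card_le_card (union_subset (coset_subset (le_stab_cl L A) (subset_cl L A ha))
      (coset_subset (le_stab_cl L A) (subset_cl L A hb)))
    rw [card_union_of_disjoint hd, card_coset, card_coset] at h1
    have h2 := card_le_card (subset_cl L A)
    have h3 := card_le_card (subset_cl L (iter A (m + 1)))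
    change _ ≤ 2 * #(A + iter A (m + 1))
    rw [show m + 1 + 2 = (m + 2) + 1 by ring, mul_add_one]
    omega

theorem iter_eq_coset_of_card_lt {A : Finset G} {K : AddSubgroup G} {a : G} (ha : a ∈ A)
    (hK : ∀ x ∈ A, x - a ∈ K) (hmin : ∀ H : AddSubgroup G, (∀ x ∈ A, x - a ∈ H) → K ≤ H) {n : ℕ}
    (hexp : AddMonoid.exponent G ≤ n) (hc : Fintype.card G < #A * n) :
    Nat.card (G ⧸ K) < n ∧
      iter A (n + 1 - Nat.card (G ⧸ K)) = coset K ((n + 1 - Nat.card (G ⧸ K)) • a) := by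
  have hcard := AddSubgroup.card_eq_card_quotient_mul_card_addSubgroup K
  rw [Nat.card_eq_fintype_card] at hcard
  have hAK : #A ≤ Nat.card K := card_le_of_forall_sub_mem hK
  have hi : 0 < Nat.card (G ⧸ K) := Nat.card_pos
  generalize hi' : Nat.card (G ⧸ K) = i at *
  have hin : i < n := by
    by_contra hcon
    push Not at hcon
    have := Nat.mul_le_mul hAK hcon
    nlinarith
  refine ⟨hin, ?_⟩
  rcases (by omega : i = 1 ∨ 2 ≤ i) with rfl | hi2
  · have hKt : K = ⊤ := by
      rw [← AddSubgroup.index_eq_one]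
      exact hi'
    subst hKt
    rw [Nat.add_sub_cancel, iter_eq_univ _ rfl ⟨a, ha⟩ ?_ hexp hc]
    · symm
      exact eq_univ_of_forall fun x => mem_coset.2 trivial
    · intro H b hb
      refine top_le_iff.1 (hmin H fun x hx => ?_)
      simpa using H.sub_mem (hb x hx) (hb a ha)
  · obtain ⟨m, rfl⟩ : ∃ m, n = m + 1 + i := ⟨n - i - 1, by omega⟩
    rw [show m + 1 + i + 1 - i = m + 1 + 1 by omega]
    refine (iter_eq_coset_or_le ha hK hmin (m + 1)).resolve_right fun hcon => ?_
    have h1 := card_le_card (iter_subset_coset hK (m + 1 + 1))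
    rw [card_coset] at h1
    obtain ⟨j, rfl⟩ := Nat.exists_eq_add_of_le hi2
    have h2 : #A * (m + 1 + 2) ≤ 2 * Nat.card K := by omega
    have h3 := Nat.mul_le_mul_right (2 + j) h2
    have h4 : 0 ≤ #A * (j * m) := Nat.zero_le _
    nlinarith

theorem sum_min_mult_ge {S : Multiset G} {P : AddSubgroup G} {a : G} {k : ℕ}
    (ha : k ≤ mult S P a) :
    Nat.card P * k + Nat.card P * min k (Multiset.card S - mult S P a) ≤
      ∑ x, min k (mult S P x) := by
  have hco : ∀ b, ∀ x ∈ coset P b, mult S P x = mult S P b := fun b x hx =>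
    mult_congr (mem_coset.1 hx) S
  have hsum : ∀ b, k ≤ mult S P b → ∑ x ∈ coset P b, min k (mult S P x) = Nat.card P * k := by
    intro b hb
    rw [sum_congr rfl fun x hx => by rw [hco b x hx, min_eq_left hb], sum_const, card_coset,
      smul_eq_mul]
  rw [← sum_add_sum_compl (coset P a), hsum a ha]
  refine Nat.add_le_add_left ?_ _
  by_cases hex : ∃ b, b ∉ coset P a ∧ k ≤ mult S P b
  · obtain ⟨b, hb, hkb⟩ := hex
    refine (Nat.mul_le_mul_left _ (min_le_left _ _)).trans ?_
    rw [← hsum b hkb]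
    refine sum_le_sum_of_subset fun x hx => ?_
    rw [mem_compl]
    intro hx'
    refine hb (mem_coset.2 ?_)
    have := P.sub_mem (mem_coset.1 hx') (mem_coset.1 hx)
    simpa using this
  · push Not at hex
    refine (Nat.mul_le_mul_left _ (min_le_right _ _)).trans ?_
    rw [sum_congr rfl fun x hx => min_eq_right (hex x (mem_compl.1 hx)).le]
    have h1 : ∑ x ∈ coset P a, mult S P x + ∑ x ∈ (coset P a)ᶜ, mult S P x = ∑ x, mult S P x :=
      sum_add_sum_compl _ _
    rw [sum_mult, sum_congr rfl (hco a), sum_const, card_coset, smul_eq_mul] at h1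
    rw [Nat.mul_sub]
    exact Nat.sub_le_iff_le_add'.2 h1.ge

theorem cl_sums_eq_univ {S : Multiset G} {K : AddSubgroup G} {a : G}
    (ha : Nat.card (G ⧸ K) - 1 ≤ mult S K a)
    (hc : ∀ H : AddSubgroup G, H ≠ ⊤ → mult S H a + (Nat.card (G ⧸ H) - 1) ≤ Multiset.card S) :
    cl K (sums S (Nat.card (G ⧸ K) - 1)) = univ := by
  set k := Nat.card (G ⧸ K) - 1 with hk
  have hS : k ≤ Multiset.card S := ha.trans (mult_le_card _ _ _)
  set P := stab (cl K (sums S k)) with hP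
  have hKP : K ≤ P := le_stab_cl _ _
  have hcl : cl P (sums S k) = cl K (sums S k) := by
    rw [← cl_cl hKP, cl_eq_of_le_stab le_rfl]
  have hne : (cl K (sums S k)).Nonempty := (sums_nonempty hS).mono (subset_cl _ _)
  by_cases hPt : P = ⊤
  · exact eq_univ_of_top_le_stab hne hPt.ge
  have hdgm := dgm S k P hS (by rw [hcl])
  unfold DGMIneq at hdgm
  rw [hcl] at hdgm
  have hsum := sum_min_mult_ge (ha.trans (mult_mono_left hKP S a))
  have hcP := hc P hPt
  have hcardP := AddSubgroup.card_eq_card_quotient_mul_card_addSubgroup P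
  have hcardK := AddSubgroup.card_eq_card_quotient_mul_card_addSubgroup K
  have hle : Nat.card (G ⧸ P) ≤ Nat.card (G ⧸ K) :=
    Nat.le_of_dvd Nat.card_pos (AddSubgroup.index_dvd_of_le hKP)
  have hp : 0 < Nat.card (G ⧸ P) := Nat.card_pos
  have hmin : Nat.card (G ⧸ P) - 1 ≤ min k (Multiset.card S - mult S P a) :=
    le_min (by omega) (by omega)
  have h1 := Nat.mul_le_mul_left (Nat.card P) hmin
  have h2 : Nat.card P * (Nat.card (G ⧸ P) - 1) + Nat.card P = Fintype.card G := by
    rw [← Nat.mul_add_one, Nat.sub_add_cancel hp, mul_comm, ← hcardP, Nat.card_eq_fintype_card]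
  rw [← card_eq_iff_eq_univ]
  refine le_antisymm (card_le_univ _) ?_
  rw [mul_comm k] at hdgm
  omega

theorem sums_eq_univ_of_card_lt {S : Multiset G} {n : ℕ} (hexp : AddMonoid.exponent G ≤ n)
    (hcard : Fintype.card G < #{x | n ≤ S.count x} * n)
    (hc : ∀ H : AddSubgroup G, H ≠ ⊤ → ∀ a,
      mult S H a + (Nat.card (G ⧸ H) - 1) ≤ Multiset.card S) :
    sums S n = univ := by
  set A : Finset G := {x | n ≤ S.count x} with hA
  obtain ⟨a, ha⟩ : A.Nonempty := by
    rw [← card_pos]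
    by_contra hcon
    rw [Nat.eq_zero_of_not_pos hcon] at hcard
    omega
  set K := AddSubgroup.closure {x | x + a ∈ A} with hK
  have hAK : ∀ x ∈ A, x - a ∈ K := fun x hx => AddSubgroup.subset_closure (by simpa using hx)
  have hmin : ∀ H : AddSubgroup G, (∀ x ∈ A, x - a ∈ H) → K ≤ H := fun H hH =>
    (AddSubgroup.closure_le H).2 fun x hx => by simpa using hH _ hx
  obtain ⟨hin, hit⟩ := iter_eq_coset_of_card_lt ha hAK hmin hexp hcard
  have hi : 0 < Nat.card (G ⧸ K) := Nat.card_pos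
  have hcount : S.count a ≤ mult S K a := by
    rw [Multiset.count]
    unfold mult
    rw [Multiset.countP_eq_card_filter]
    refine Multiset.card_le_card (Multiset.monotone_filter_right S fun y hy => ?_)
    subst hy
    simp
  have haA : n ≤ S.count a := (mem_filter.1 ha).2
  have hcl := cl_sums_eq_univ (K := K) (a := a) (S := S) (by omega) fun H hH => hc H hH a
  refine eq_univ_of_forall fun z => ?_
  obtain ⟨t, ht, htz⟩ := mem_cl.1
    (hcl ▸ mem_univ (z - (n + 1 - Nat.card (G ⧸ K)) • a) : _ ∈ cl K _)
  obtain ⟨T, hTS, hTc, rfl⟩ := mem_sums.1 ht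
  have hz : z - T.sum ∈ iter A (n + 1 - Nat.card (G ⧸ K)) := by
    rw [hit, mem_coset, sub_right_comm]
    exact htz
  obtain ⟨U, hU, hUc, hUs⟩ := mem_iter.1 hz
  refine mem_sums.2 ⟨T + U, ?_, ?_, ?_⟩
  · rw [Multiset.le_iff_count]
    intro x
    by_cases hx : x ∈ U
    · refine (Multiset.count_le_card x _).trans ?_
      have : n ≤ S.count x := (mem_filter.1 (hU x hx)).2
      rw [Multiset.card_add]
      omega
    · rw [Multiset.count_add, Multiset.count_eq_zero_of_notMem hx, add_zero]
      exact Multiset.count_le_of_le x hTS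
  · rw [Multiset.card_add]
    omega
  · rw [Multiset.sum_add, hUs]
    abel

end Assembly

section Main

variable {G : Type u} [AddCommGroup G]

theorem mult_map_mk (S : Multiset G) (H : AddSubgroup G) (P : AddSubgroup (G ⧸ H)) (x : G) :
    mult (S.map (QuotientAddGroup.mk' H)) P (x : G ⧸ H) =
      mult S (P.comap (QuotientAddGroup.mk' H)) x := by
  unfold mult
  rw [Multiset.filter_map, Multiset.card_map]
  rfl

variable [Fintype G]

theorem mult_le_mul {S : Multiset G} {n : ℕ} (h : ∀ x, S.count x ≤ n) (H : AddSubgroup G) (x : G) :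
    mult S H x ≤ Nat.card H * n := by
  unfold mult
  rw [← Multiset.sum_count_eq_card (s := coset H x) fun y hy => mem_coset.2 (Multiset.mem_filter.1 hy).2,
    ← card_coset H x, ← smul_eq_mul]
  exact sum_le_card_nsmul _ _ _ fun y _ =>
    (Multiset.count_le_of_le y (Multiset.filter_le _ _)).trans (h y)

theorem mem_cl_sums_of_mk_mem (S : Multiset G) (H : AddSubgroup G) {n : ℕ} {z : G}
    (hz : (z : G ⧸ H) ∈ sums (S.map (QuotientAddGroup.mk' H)) n) : z ∈ cl H (sums S n) := by
  obtain ⟨T, hT, hTn, hTz⟩ := mem_sums.1 hz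
  have hT' := Multiset.mem_powersetCard.2 ⟨hT, hTn⟩
  rw [Multiset.powersetCard_map] at hT'
  obtain ⟨U, hU, rfl⟩ := Multiset.mem_map.1 hT'
  obtain ⟨hUS, hUn⟩ := Multiset.mem_powersetCard.1 hU
  refine mem_cl.2 ⟨U.sum, mem_sums.2 ⟨U, hUS, hUn, rfl⟩, QuotientAddGroup.eq_iff_sub_mem.1 ?_⟩
  rw [← hTz, ← map_multiset_sum]
  rfl

theorem card_lt_card_mul {S : Multiset G} {n : ℕ} (hlen : n + Fintype.card G ≤ Multiset.card S + 1)
    (hmult : ∀ x, S.count x ≤ n) (hS : n ≤ Multiset.card S) (hne : sums S n ≠ univ) :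
    Fintype.card G < #{x | n ≤ mult S (stab (sums S n)) x} * n := by
  set H := stab (sums S n) with hH
  have hdgm := dgm S n H hS (by rw [cl_eq_of_le_stab le_rfl])
  unfold DGMIneq at hdgm
  rw [cl_eq_of_le_stab le_rfl] at hdgm
  set B : Finset G := {x | n ≤ mult S H x} with hB
  have hh : 0 < Nat.card H := Nat.card_pos
  have hlt : #(sums S n) + Nat.card H ≤ Fintype.card G := by
    obtain ⟨c, hc⟩ := card_dvd_of_le_stab (le_rfl : H ≤ stab (sums S n))
    have hq := AddSubgroup.card_eq_card_quotient_mul_card_addSubgroup H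
    rw [Nat.card_eq_fintype_card, mul_comm] at hq
    have hl := (card_lt_iff_ne_univ _).2 hne
    rw [hq, hc] at hl ⊢
    have := Nat.lt_of_mul_lt_mul_left hl
    rw [← mul_add_one]
    exact Nat.mul_le_mul_left _ this
  have h1 : ∑ x ∈ B, min n (mult S H x) + ∑ x ∈ Bᶜ, min n (mult S H x) =
      ∑ x, min n (mult S H x) := sum_add_sum_compl _ _
  have h2 : ∑ x ∈ B, mult S H x + ∑ x ∈ Bᶜ, mult S H x = ∑ x, mult S H x := sum_add_sum_compl _ _
  have h1a : ∑ x ∈ B, min n (mult S H x) = #B * n :=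
    sum_const_nat fun x hx => min_eq_left (by simpa [hB] using hx)
  have h1b : ∑ x ∈ Bᶜ, min n (mult S H x) = ∑ x ∈ Bᶜ, mult S H x :=
    sum_congr rfl fun x hx => min_eq_right (by simpa [hB] using hx : _ < _).le
  rw [h1a, h1b] at h1
  rw [sum_mult] at h2
  have h3 : ∑ x ∈ B, mult S H x ≤ #B * (Nat.card H * n) :=
    sum_le_card_nsmul _ _ _ fun x _ => mult_le_mul hmult H x
  by_contra hcon
  push Not at hcon
  obtain ⟨D, hD⟩ := Nat.exists_eq_add_of_le hcon
  have h4 := Nat.mul_le_mul_left (Nat.card H) hlen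
  have h5 : D ≤ Nat.card H * D := Nat.le_mul_of_pos_left _ hh
  rw [hD] at h4 hlt
  have h6 : #B * (Nat.card H * n) = Nat.card H * (#B * n) := by ring
  rw [mul_comm n] at hdgm
  simp only [mul_add, mul_one] at h4
  omega

theorem sums_eq_univ {S : Multiset G} {n : ℕ} (hexp : AddMonoid.exponent G ≤ n)
    (hlen : n + Fintype.card G ≤ Multiset.card S + 1) (hmult : ∀ x, S.count x ≤ n)
    (hc : ∀ H : AddSubgroup G, H ≠ ⊤ → ∀ a,
      mult S H a + (Nat.card (G ⧸ H) - 1) ≤ Multiset.card S) :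
    sums S n = univ := by
  by_contra hne
  have hG : 0 < Fintype.card G := Fintype.card_pos
  have hlt := card_lt_card_mul hlen hmult (by omega) hne
  set H := stab (sums S n) with hH
  have hh : 0 < Nat.card H := Nat.card_pos
  have hq := AddSubgroup.card_eq_card_quotient_mul_card_addSubgroup H
  rw [Nat.card_eq_fintype_card, Nat.card_eq_fintype_card (α := G ⧸ H), mul_comm] at hq
  have hcount : ∀ x : G,
      (S.map (QuotientAddGroup.mk' H)).count (QuotientAddGroup.mk' H x) = mult S H x := by
    intro x
    rw [← card_slice, ← count_map_mk]
    rfl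
  have hB := card_le_card_mul_card_image_mk H {x | n ≤ mult S H x}
  have hsub : image (QuotientAddGroup.mk' H) {x | n ≤ mult S H x} ⊆
      ({q | n ≤ (S.map (QuotientAddGroup.mk' H)).count q} : Finset (G ⧸ H)) := by
    intro q hq
    obtain ⟨x, hx, rfl⟩ := mem_image.1 hq
    rw [mem_filter, hcount]
    exact ⟨mem_univ _, (mem_filter.1 hx).2⟩
  have hB' := hB.trans (Nat.mul_le_mul_left _ (card_le_card hsub))
  have hexpQ : AddMonoid.exponent (G ⧸ H) ≤ n :=
    (Nat.le_of_dvd (Nat.pos_of_ne_zero AddMonoid.exponent_ne_zero_of_finite)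
      (AddGroup.exponent_quotient_dvd H)).trans hexp
  have hmain := sums_eq_univ_of_card_lt (S := S.map (QuotientAddGroup.mk' H)) hexpQ
    (by
      refine Nat.lt_of_mul_lt_mul_left (a := Nat.card H) ?_
      rw [← hq, ← mul_assoc]
      exact hlt.trans_le (Nat.mul_le_mul_right _ (by convert hB'; rfl)))
    fun P hP q => by
      obtain ⟨x, rfl⟩ := QuotientAddGroup.mk'_surjective H q
      have hidx : Nat.card (G ⧸ P.comap (QuotientAddGroup.mk' H)) = Nat.card ((G ⧸ H) ⧸ P) :=
        AddSubgroup.index_comap_of_surjective P (QuotientAddGroup.mk'_surjective H)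
      have := hc (P.comap (QuotientAddGroup.mk' H)) (fun htop => hP (by
        rw [← AddSubgroup.index_eq_one] at htop ⊢
        rwa [AddSubgroup.index_comap_of_surjective P (QuotientAddGroup.mk'_surjective H)] at htop))
        x
      rw [hidx, ← mult_map_mk] at this
      rwa [Multiset.card_map]
  refine hne (eq_univ_of_forall fun z => ?_)
  rw [← cl_eq_of_le_stab (le_rfl : H ≤ stab (sums S n))]
  exact mem_cl_sums_of_mk_mem S H (hmain ▸ mem_univ _)

end Main

end SubseqSum

open scoped Pointwise Classical in
theorem stmt_13 {G : Type*} [AddCommGroup G] [Fintype G]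
    (n : ℕ) (hn : AddMonoid.exponent G ≤ n)
    (S : Multiset G)
    (hlen : n + Nat.card G - 1 ≤ Multiset.card S)
    (hmult : ∀ x : G, S.count x ≤ n)
    (hcoset : ∀ H : AddSubgroup G, H ≠ ⊤ → ∀ α : G,
      Nat.card (G ⧸ H) - 1 ≤
        Multiset.card (S.filter fun x => x ∉ α +ᵥ (H : Set G))) :
    subseqSums S n = Set.univ := by
  have hmain : SubseqSum.sums S n = Finset.univ := by
    refine SubseqSum.sums_eq_univ hn ?_ (fun x => ?_) fun H hH a => ?_
    · rw [← Nat.card_eq_fintype_card]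
      omega
    · convert hmult x
    · have h1 := hcoset H hH a
      have h2 := congrArg Multiset.card
        (Multiset.filter_add_not (fun x => x ∈ a +ᵥ (H : Set G)) S)
      have h3 : SubseqSum.mult S H a =
          Multiset.card (S.filter fun x => x ∈ a +ᵥ (H : Set G)) := by
        unfold SubseqSum.mult
        congr 1
        refine Multiset.filter_congr fun x _ => ?_
        rw [Set.mem_vadd_set_iff_neg_vadd_mem, vadd_eq_add, neg_add_eq_sub, SetLike.mem_coe]
      rw [Multiset.card_add] at h2
      omega
  refine Set.eq_univ_of_forall fun x => ?_
  exact SubseqSum.mem_sums.1 (hmain ▸ Finset.mem_univ x)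
end
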